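/- Let p be a prime with p ≡ 2 (mod 3) and let s ∈ F_p^×. Then |c(s)| ≤ (4/3)√p, where c(s) = ∑_{b ∈ F(s)} e^{2πi b̃/p}, F(s) = {b ∈ F_p : (s, b) ∈ O_cubes}, and b̃ ∈ {0, …, p−1} is the integer representative of b. -/

import Mathlib

/-!
Setup: the set `O_cubes` of pairs `(a, b) ∈ 𝔽_p² \ {0}` such that `a + b√ε` is a cube in
`𝔽_{p²}^×`, where `ε` is the least positive quadratic non-residue modulo `p` and
`𝔽_{p²} = 𝔽_p(√ε)`.
-/

noncomputable section

/-- The least positive integer which is a quadratic non-residue modulo `p`. -/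
def leastNonResidue (p : ℕ) : ℕ :=
  sInf {n : ℕ | 0 < n ∧ ¬∃ x : ZMod p, x ^ 2 = (n : ZMod p)}

/-- `ε ∈ 𝔽_p`: the reduction mod `p` of the least positive quadratic non-residue. -/
def nsEps (p : ℕ) : ZMod p := (leastNonResidue p : ZMod p)

/-- `O_cubes`: the set of pairs `(a, b) ∈ 𝔽_p² \ {(0,0)}` such that `a + b·r` is a cube in
`𝔽_{p²}^×`, where `𝔽_{p²}` is realised as `GaloisField p 2` and `r` is a square root of `ε`
(so that `𝔽_{p²} = 𝔽_p(√ε)` and `r = √ε`). -/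
def Ocubes (p : ℕ) [Fact p.Prime] (r : GaloisField p 2) : Set (ZMod p × ZMod p) :=
  {ab | ab ≠ 0 ∧ ∃ c : GaloisField p 2, c ≠ 0 ∧
    c ^ 3 = algebraMap (ZMod p) (GaloisField p 2) ab.1 +
      algebraMap (ZMod p) (GaloisField p 2) ab.2 * r}

end

/-- `c(s) = ∑_{b ∈ F(s)} e^{2πi b̃/p}`, where `F(s) = {b ∈ 𝔽_p : (s, b) ∈ O_cubes}` and
`b̃ ∈ {0, …, p-1}` is the integer representative of `b`. -/
noncomputable def cfun (p : ℕ) [Fact p.Prime] (r : GaloisField p 2) (s : ZMod p) : ℂ :=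
  ∑ᶠ b ∈ {b : ZMod p | (s, b) ∈ Ocubes p r},
    Complex.exp (2 * Real.pi * Complex.I * (ZMod.val b : ℂ) / p)

section helpers
open Polynomial


/-- the polynomial attached to a coefficient vector -/
noncomputable def stPoly {K : Type*} [Field K] {M : ℕ} (c : Fin M → K) : K[X] :=
  ∑ i : Fin M, C (c i) * X ^ (i : ℕ)

lemma stPoly_sub {K : Type*} [Field K] {M : ℕ} (c d : Fin M → K) :
    stPoly (c - d) = stPoly c - stPoly d := by
  simp [stPoly, sub_mul, Finset.sum_sub_distrib]

lemma stPoly_coeff {K : Type*} [Field K] {M : ℕ} (c : Fin M → K) (i : Fin M) :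
    (stPoly c).coeff i = c i := by
  simp [stPoly, coeff_X_pow, Fin.val_inj]

lemma stPoly_natDegree {K : Type*} [Field K] {M : ℕ} (hM : 0 < M) (c : Fin M → K) :
    (stPoly c).natDegree ≤ M - 1 := by
  refine natDegree_sum_le_of_forall_le _ _ fun i _ => ?_
  refine (natDegree_C_mul_X_pow_le _ _).trans ?_
  have := i.2
  omega

lemma stPoly_ne_zero {K : Type*} [Field K] {M : ℕ} (c : Fin M → K) (hc : c ≠ 0) :
    stPoly c ≠ 0 := by
  intro h
  apply hc
  funext i
  rw [← stPoly_coeff c i, h]; simp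

/-- index type: (β, k, α) -/
abbrev StIdx (N : ℕ) := Fin 3 × Fin 3 × Fin N

/-- coordinate of `H` -/
noncomputable def stH {K : Type*} [Field K] {M N : ℕ} (h : K[X]) (q₀ e : ℕ)
    (u : StIdx N → Fin M → K) (t : Fin 3) : K[X] :=
  ∑ x : StIdx N with (x.1.val + x.2.1.val) % 3 = t.val,
    stPoly (u x) ^ q₀ * h ^ (x.2.1.val * e + (x.1.val + x.2.1.val) / 3) * X ^ (x.2.2 : ℕ)

/-- coordinate of `G` -/
noncomputable def stG {K : Type*} [Field K] {M N : ℕ} (h : K[X]) (q₀ e : ℕ)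
    (u : StIdx N → Fin M → K) (t : Fin 3) : K[X] :=
  ∑ x : StIdx N with (x.1.val + x.2.1.val) % 3 = t.val,
    stPoly (u x) * h ^ (x.1.val * e + (x.1.val + x.2.1.val) / 3) * X ^ ((x.2.2 : ℕ) * q₀)

lemma stH_sub {K : Type*} [Field K] {M N : ℕ} (h : K[X]) (ℓ m e : ℕ) [Fact ℓ.Prime] [CharP K ℓ]
    (u v : StIdx N → Fin M → K) (t : Fin 3) :
    stH h (ℓ ^ m) e (u - v) t = stH h (ℓ ^ m) e u t - stH h (ℓ ^ m) e v t := by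
  unfold stH
  rw [← Finset.sum_sub_distrib]
  refine Finset.sum_congr rfl fun x _ => ?_
  rw [Pi.sub_apply, stPoly_sub, sub_pow_char_pow]
  ring

lemma stH_natDegree {K : Type*} [Field K] {M N : ℕ} (hM : 0 < M) (h : K[X]) (q₀ e : ℕ)
    (u : StIdx N → Fin M → K) (t : Fin 3) :
    (stH h q₀ e u t).natDegree ≤ q₀ * (M - 1) + h.natDegree * (2 * e + 1) + (N - 1) := by
  refine natDegree_sum_le_of_forall_le _ _ fun x _ => ?_
  have h1 := stPoly_natDegree hM (u x)
  have hx1 := x.1.2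
  have hx2 := x.2.1.2
  have hx3 := x.2.2.2
  refine natDegree_mul_le.trans ?_
  refine add_le_add (natDegree_mul_le.trans (add_le_add ?_ ?_)) ?_
  · exact natDegree_pow_le.trans (Nat.mul_le_mul_left _ h1)
  · refine natDegree_pow_le.trans ?_
    rw [mul_comm]
    refine Nat.mul_le_mul_left _ ?_
    have : x.2.1.val * e ≤ 2 * e := Nat.mul_le_mul_right _ (by omega)
    omega
  · rw [natDegree_X_pow]; omega

lemma stG_natDegree {K : Type*} [Field K] {M N : ℕ} (hM : 0 < M) (h : K[X]) (q₀ e : ℕ)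
    (u : StIdx N → Fin M → K) (t : Fin 3) :
    (stG h q₀ e u t).natDegree ≤ (M - 1) + h.natDegree * (2 * e + 1) + (N - 1) * q₀ := by
  refine natDegree_sum_le_of_forall_le _ _ fun x _ => ?_
  have h1 := stPoly_natDegree hM (u x)
  have hx1 := x.1.2
  have hx2 := x.2.1.2
  have hx3 := x.2.2.2
  refine natDegree_mul_le.trans ?_
  refine add_le_add (natDegree_mul_le.trans (add_le_add h1 ?_)) ?_
  · refine natDegree_pow_le.trans ?_
    rw [mul_comm]
    refine Nat.mul_le_mul_left _ ?_
    have : x.1.val * e ≤ 2 * e := Nat.mul_le_mul_right _ (by omega)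
    omega
  · rw [natDegree_X_pow]; exact Nat.mul_le_mul_right _ (by omega)

lemma stG_ne_zero {K : Type*} [Field K] {M N : ℕ} (hM : 0 < M) (h : K[X]) (q₀ e D : ℕ)
    (hq : q₀ = 3 * e + 1) (hD : h.natDegree = D) (hD3 : ¬ 3 ∣ D) (hMD : 3 * (M - 1) + 2 * D < q₀)
    (u : StIdx N → Fin M → K) (hu : u ≠ 0) : ∃ t, stG h q₀ e u t ≠ 0 := by
  have hh : h ≠ 0 := by rintro rfl; simp at hD; subst hD; simp at hD3
  obtain ⟨x₀, hx₀⟩ := Function.ne_iff.mp hu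
  refine ⟨⟨(x₀.1.val + x₀.2.1.val) % 3, Nat.mod_lt _ (by norm_num)⟩, ?_⟩
  set t : Fin 3 := ⟨(x₀.1.val + x₀.2.1.val) % 3, Nat.mod_lt _ (by norm_num)⟩ with ht
  unfold stG
  set s : Finset (StIdx N) := Finset.univ.filter fun x : StIdx N => (x.1.val + x.2.1.val) % 3 = t.val
  set f : StIdx N → K[X] := fun x => stPoly (u x) *
    h ^ (x.1.val * e + (x.1.val + x.2.1.val) / 3) * X ^ ((x.2.2 : ℕ) * q₀) with hf
  have hdeg : ∀ x, stPoly (u x) ≠ 0 → f x ≠ 0 ∧ (f x).natDegree = (stPoly (u x)).natDegree +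
      (x.1.val * e + (x.1.val + x.2.1.val) / 3) * D + x.2.2 * q₀ := by
    intro x hx
    have h1 : h ^ (x.1.val * e + (x.1.val + x.2.1.val) / 3) ≠ 0 := pow_ne_zero _ hh
    have h2 : (X : K[X]) ^ ((x.2.2 : ℕ) * q₀) ≠ 0 := pow_ne_zero _ X_ne_zero
    refine ⟨mul_ne_zero (mul_ne_zero hx h1) h2, ?_⟩
    simp only [hf]
    rw [natDegree_mul (mul_ne_zero hx h1) h2, natDegree_mul hx h1, natDegree_pow, natDegree_X_pow, hD]
  have hpair : Set.Pairwise {i | i ∈ s ∧ f i ≠ 0} (Function.onFun (· ≠ ·) (degree ∘ f)) := by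
    intro x hx y hy hxy hE
    have hx' : stPoly (u x) ≠ 0 := fun h0 => hx.2 (by simp [hf, h0])
    have hy' : stPoly (u y) ≠ 0 := fun h0 => hy.2 (by simp [hf, h0])
    have hE' : (f x).natDegree = (f y).natDegree := by
      simpa [natDegree] using congrArg (WithBot.unbotD 0) hE
    rw [(hdeg x hx').2, (hdeg y hy').2] at hE'
    have hxs : (x.1.val + x.2.1.val) % 3 = t.val := (Finset.mem_filter.mp hx.1).2
    have hys : (y.1.val + y.2.1.val) % 3 = t.val := (Finset.mem_filter.mp hy.1).2
    have dx := stPoly_natDegree hM (u x)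
    have dy := stPoly_natDegree hM (u y)
    apply hxy
    obtain ⟨⟨b, hb⟩, ⟨k, hk⟩, ⟨a, ha⟩⟩ := x
    obtain ⟨⟨b', hb'⟩, ⟨k', hk'⟩, ⟨a', ha'⟩⟩ := y
    simp only at hE' hxs hys
    generalize (stPoly (u (⟨b, hb⟩, ⟨k, hk⟩, ⟨a, ha⟩))).natDegree = d at *
    generalize (stPoly (u (⟨b', hb'⟩, ⟨k', hk'⟩, ⟨a', ha'⟩))).natDegree = d' at *
    have e1 : 3 * ((b + k) / 3) + t.val = b + k := by omega
    have e2 : 3 * ((b' + k') / 3) + t.val = b' + k' := by omega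
    generalize (b + k) / 3 = w at *
    generalize (b' + k') / 3 = w' at *
    have key : (3 * d + D * k) + q₀ * (3 * a + D * b) = (3 * d' + D * k') + q₀ * (3 * a' + D * b') := by
      have e1' : D * (3 * w + t.val) = D * (b + k) := by rw [e1]
      have e2' : D * (3 * w' + t.val) = D * (b' + k') := by rw [e2]
      subst hq
      nlinarith
    have l1 : 3 * d + D * k < q₀ := by
      have : D * k ≤ D * 2 := Nat.mul_le_mul_left _ (by omega)
      omega
    have l2 : 3 * d' + D * k' < q₀ := by
      have : D * k' ≤ D * 2 := Nat.mul_le_mul_left _ (by omega)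
      omega
    have m1 : 3 * d + D * k = 3 * d' + D * k' := by
      have := congrArg (· % q₀) key
      simpa [Nat.add_mul_mod_self_left, Nat.mod_eq_of_lt l1, Nat.mod_eq_of_lt l2] using this
    have m2 : 3 * a + D * b = 3 * a' + D * b' := by
      have : q₀ * (3 * a + D * b) = q₀ * (3 * a' + D * b') := by omega
      exact Nat.eq_of_mul_eq_mul_left (by omega) this
    have aux : ∀ z z' i i' : ℕ, i < 3 → i' < 3 → 3 * z + D * i = 3 * z' + D * i' → i = i' := by
      intro z z' i i' hi hi' hz
      interval_cases i <;> interval_cases i' <;> omega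
    have hkk := aux _ _ _ _ hk hk' m1
    have hbb := aux _ _ _ _ hb hb' m2
    subst hkk hbb
    have : a = a' := by omega
    subst this
    rfl
  have hx₀s : x₀ ∈ s := by simp [s, ht]
  have hfx₀ := (hdeg x₀ (stPoly_ne_zero _ hx₀)).1
  intro h0
  have := degree_sum_eq_of_disjoint f s hpair
  rw [h0] at this
  have hle := Finset.le_sup (f := fun i => degree (f i)) hx₀s
  rw [← this, degree_zero, le_bot_iff, degree_eq_bot] at hle
  exact hfx₀ hle

lemma st_eval_sum {K : Type*} [Field K] (q₀ e : ℕ) {M N : ℕ} (h : K[X])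
    (u : StIdx N → Fin M → K) (v w : K) (hw : w ^ 3 = h.eval v) :
    ∑ t : Fin 3, (stG h q₀ e u t).eval v * w ^ (t : ℕ) =
      ∑ x : StIdx N, (stPoly (u x)).eval v * w ^ (x.1.val * (3 * e + 1) + x.2.1.val) * v ^ (x.2.2.val * q₀) := by
  unfold stG
  simp only [eval_finsetSum, Finset.sum_mul]
  rw [← Finset.sum_fiberwise (s := (Finset.univ : Finset (StIdx N)))
    (g := fun x => (⟨(x.1.val + x.2.1.val) % 3, Nat.mod_lt _ (by norm_num)⟩ : Fin 3))]
  refine Finset.sum_congr rfl fun t _ => ?_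
  simp only [Fin.ext_iff]
  refine Finset.sum_congr rfl fun x hx => ?_
  have hx := (Finset.mem_filter.mp hx).2
  simp only [eval_mul, eval_pow, eval_X, ← hw, ← pow_mul]
  have : x.1.val * (3 * e + 1) + x.2.1.val = 3 * (x.1.val * e + (x.1.val + x.2.1.val) / 3) + t.val := by
    have : x.1.val * (3 * e + 1) = 3 * (x.1.val * e) + x.1.val := by ring
    omega
  rw [this, pow_add]
  ring

lemma stH_eval_sum {K : Type*} [Field K] (q₀ e : ℕ) {M N : ℕ} (h : K[X])
    (u : StIdx N → Fin M → K) (v w : K) (hw : w ^ 3 = h.eval v) :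
    ∑ t : Fin 3, (stH h q₀ e u t).eval v * w ^ (t : ℕ) =
      ∑ x : StIdx N, (stPoly (u x)).eval v ^ q₀ * w ^ (x.2.1.val * (3 * e + 1) + x.1.val) * v ^ (x.2.2.val) := by
  unfold stH
  simp only [eval_finsetSum, Finset.sum_mul]
  rw [← Finset.sum_fiberwise (s := (Finset.univ : Finset (StIdx N)))
    (g := fun x => (⟨(x.1.val + x.2.1.val) % 3, Nat.mod_lt _ (by norm_num)⟩ : Fin 3))]
  refine Finset.sum_congr rfl fun t _ => ?_
  simp only [Fin.ext_iff]
  refine Finset.sum_congr rfl fun x hx => ?_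
  have hx := (Finset.mem_filter.mp hx).2
  simp only [eval_mul, eval_pow, eval_X, ← hw, ← pow_mul]
  have : x.2.1.val * (3 * e + 1) + x.1.val = 3 * (x.2.1.val * e + (x.1.val + x.2.1.val) / 3) + t.val := by
    have : x.2.1.val * (3 * e + 1) = 3 * (x.2.1.val * e) + x.2.1.val := by ring
    omega
  rw [this, pow_add]
  ring

/-- Stepanov bound for the number of points where `h` is a nonzero cube. -/
theorem stepanov_bound {K : Type*} [Field K] [Fintype K] [DecidableEq K] (ℓ m e D : ℕ)
    [Fact ℓ.Prime] [CharP K ℓ]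
    (hq : ℓ ^ m = 3 * e + 1) (hcard : Fintype.card K = (ℓ ^ m) ^ 2)
    (h : K[X]) (hD : h.natDegree = D) (hD3 : ¬ 3 ∣ D) (he : 3 * D + 1 ≤ e)
    (S : Finset K) (hS : ∀ v ∈ S, ∃ w : K, w ≠ 0 ∧ w ^ 3 = h.eval v) :
    3 * S.card ≤ (ℓ ^ m) ^ 2 + (5 * D + 1) * ℓ ^ m := by
  set q₀ := ℓ ^ m with hq₀
  obtain ⟨M, hM⟩ : ∃ M, M + D = e := ⟨e - D, by omega⟩
  set N := e + 1 + D with hN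
  have hMpos : 0 < M := by omega
  set E := q₀ * (M - 1) + h.natDegree * (2 * e + 1) + N with hE
  -- pigeonhole
  let Φ : (StIdx N → Fin M → K) → (Fin 3 → Fin E → K) :=
    fun u t i => (stH h q₀ e u t).coeff i
  have hlt : Fintype.card (Fin 3 → Fin E → K) < Fintype.card (StIdx N → Fin M → K) := by
    simp only [Fintype.card_fun, Fintype.card_fin, Fintype.card_prod]
    rw [← pow_mul, ← pow_mul]
    refine Nat.pow_lt_pow_right Fintype.one_lt_card ?_
    obtain ⟨M', rfl⟩ : ∃ M', M = M' + 1 := ⟨M - 1, by omega⟩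
    rw [hE, hD, hN, hq]
    simp only [Nat.add_sub_cancel]
    subst hM
    obtain ⟨j, rfl⟩ : ∃ j, M' = 2 * D + j := ⟨M' - 2 * D, by omega⟩
    nlinarith [Nat.zero_le (D * j), Nat.zero_le (D*D), Nat.zero_le j, Nat.zero_le (j*j)]
  obtain ⟨u₁, u₂, hne, hu⟩ := Fintype.exists_ne_map_eq_of_card_lt Φ hlt
  set u := u₁ - u₂ with hu'
  have hune : u ≠ 0 := sub_ne_zero.mpr hne
  have hH : ∀ t, stH h q₀ e u t = 0 := by
    intro t
    rw [hu', hq₀, stH_sub, sub_eq_zero]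
    ext i
    by_cases hi : i < E
    · exact congrFun (congrFun hu t) ⟨i, hi⟩
    · rw [← hq₀]
      have b1 := stH_natDegree hMpos h q₀ e u₁ t
      have b2 := stH_natDegree hMpos h q₀ e u₂ t
      rw [coeff_eq_zero_of_natDegree_lt, coeff_eq_zero_of_natDegree_lt] <;> omega
  obtain ⟨t, ht⟩ := stG_ne_zero hMpos h q₀ e D hq hD hD3 (by omega) u hune
  -- roots
  have hω : ∃ ω : K, ω ≠ 1 ∧ ω ^ 3 = 1 := by
    have h3 : (3 : ℕ) ∣ Fintype.card Kˣ := by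
      rw [Fintype.card_units, hcard, hq]
      exact ⟨3 * e ^ 2 + 2 * e, by ring_nf; omega⟩
    obtain ⟨g, hg⟩ := IsCyclic.exists_ofOrder_eq_natCard (α := Kˣ)
    rw [Nat.card_eq_fintype_card] at hg
    obtain ⟨n, hn⟩ := h3
    have hn0 : 0 < n := by
      have := Fintype.card_pos (α := Kˣ); omega
    refine ⟨((g ^ n : Kˣ) : K), ?_, ?_⟩
    · rw [Ne, Units.val_eq_one]
      intro h1
      have := orderOf_dvd_of_pow_eq_one h1
      have := Nat.le_of_dvd hn0 this
      omega
    · rw [← Units.val_pow_eq_pow_val, ← pow_mul, mul_comm n 3, ← hn, ← hg, pow_orderOf_eq_one]; rfl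
  obtain ⟨ω, hω1, hω3⟩ := hω
  have hω0 : ω ≠ 0 := by rintro rfl; simp at hω3
  have hquad : ω ^ 2 + ω + 1 = 0 := by
    have : (ω - 1) * (ω ^ 2 + ω + 1) = 0 := by ring_nf; rw [hω3]; ring
    exact (mul_eq_zero.mp this).resolve_left (sub_ne_zero.mpr hω1)
  have h3ne : (3 : K) ≠ 0 := by
    intro h3
    have : (ω - 1) ^ 2 = 0 := by linear_combination hquad - ω * h3
    exact hω1 (sub_eq_zero.mp (pow_eq_zero_iff (two_ne_zero) |>.mp this))
  have hzero : ∀ v ∈ S, ∀ w : K, w ≠ 0 → w ^ 3 = h.eval v →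
      ∑ t : Fin 3, (stG h q₀ e u t).eval v * w ^ (t : ℕ) = 0 := by
    intro v hv w hw0 hw
    have hGp : (∑ t : Fin 3, (stG h q₀ e u t).eval v * w ^ (t : ℕ)) ^ q₀ =
        ∑ t : Fin 3, (stH h q₀ e u t).eval v * w ^ (t : ℕ) := by
      rw [st_eval_sum q₀ e h u v w hw, stH_eval_sum q₀ e h u v w hw]
      rw [hq₀, sum_pow_char_pow]
      refine Finset.sum_congr rfl fun x _ => ?_
      rw [← hq₀, ← hq, mul_pow, mul_pow, ← pow_mul, ← pow_mul]
      have fr : ∀ z : K, z ^ (q₀ * q₀) = z := by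
        intro z
        rw [← sq, ← hcard, FiniteField.pow_card]
      have a1 : w ^ ((x.1.val * q₀ + x.2.1.val) * q₀) = w ^ (x.2.1.val * q₀ + x.1.val) := by
        rw [add_mul, pow_add, pow_add, mul_assoc, mul_comm x.1.val, pow_mul, fr, mul_comm]
      have a2 : v ^ (x.2.2.val * q₀ * q₀) = v ^ x.2.2.val := by
        rw [mul_assoc, mul_comm x.2.2.val, pow_mul, fr]
      rw [a1, a2]
    have : (∑ t : Fin 3, (stG h q₀ e u t).eval v * w ^ (t : ℕ)) ^ q₀ = 0 := by
      rw [hGp]; simp [hH]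
    exact pow_eq_zero_iff (by omega) |>.mp this
  have hroots : ∀ v ∈ S, (stG h q₀ e u t).IsRoot v := by
    intro v hv
    obtain ⟨w, hw0, hw⟩ := hS v hv
    have z1 := hzero v hv w hw0 hw
    have z2 := hzero v hv (ω * w) (mul_ne_zero hω0 hw0) (by rw [mul_pow, hω3, hw, one_mul])
    have z3 := hzero v hv (ω ^ 2 * w) (mul_ne_zero (pow_ne_zero _ hω0) hw0)
      (by rw [mul_pow, ← pow_mul, mul_comm 2 3, pow_mul, hω3, hw]; ring)
    simp only [Fin.sum_univ_three, Fin.val_zero, Fin.val_one, Fin.val_two, pow_zero, mul_one, pow_one] at z1 z2 z3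
    unfold IsRoot
    have hω4 : ω ^ 4 = ω := by linear_combination ω * hω3
    have hall : (stG h q₀ e u 0).eval v = 0 ∧ (stG h q₀ e u 1).eval v = 0 ∧ (stG h q₀ e u 2).eval v = 0 := by
      have y0 : 3 * (stG h q₀ e u 0).eval v = 0 := by
        linear_combination z1 + z2 + z3 - ((stG h q₀ e u 1).eval v * w + (stG h q₀ e u 2).eval v * w ^ 2 * (1 + ω ^ 2 - ω)) * hquad
      have y1 : (3 * w) * (stG h q₀ e u 1).eval v = 0 := by
        linear_combination z1 + ω ^ 2 * z2 + ω * z3 - (stG h q₀ e u 0).eval v * hquad -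
          (stG h q₀ e u 1).eval v * w * 2 * hω3 - (stG h q₀ e u 2).eval v * w ^ 2 * (hquad + (ω + ω ^ 2) * hω3)
      have y2 : (3 * w ^ 2) * (stG h q₀ e u 2).eval v = 0 := by
        linear_combination z1 + ω * z2 + ω ^ 2 * z3 - (stG h q₀ e u 0).eval v * hquad -
          (stG h q₀ e u 1).eval v * w * (hquad + ω * hω3) - (stG h q₀ e u 2).eval v * w ^ 2 * (2 + ω ^ 3) * hω3
      exact ⟨(mul_eq_zero.mp y0).resolve_left h3ne,
        (mul_eq_zero.mp y1).resolve_left (mul_ne_zero h3ne hw0),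
        (mul_eq_zero.mp y2).resolve_left (mul_ne_zero h3ne (pow_ne_zero _ hw0))⟩
    fin_cases t
    · exact hall.1
    · exact hall.2.1
    · exact hall.2.2
  have hc : S.card ≤ (stG h q₀ e u t).natDegree := by
    have : S ⊆ (stG h q₀ e u t).roots.toFinset := by
      intro v hv
      rw [Multiset.mem_toFinset, mem_roots ht]
      exact hroots v hv
    exact (Finset.card_le_card this).trans ((Multiset.toFinset_card_le _).trans (card_roots' _))
  have hd := stG_natDegree hMpos h q₀ e u t
  have : S.card ≤ (M - 1) + D * (2 * e + 1) + (N - 1) * q₀ := by rw [← hD]; omega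
  have hN1 : N - 1 = e + D := by omega
  rw [hN1] at this
  have hM1 : M - 1 ≤ e := by omega
  rw [hq] at this ⊢
  nlinarith


lemma power_sum_bound {ι : Type*} [Fintype ι] (z : ι → ℂ) (B : ℝ) (n₀ : ℕ)
    (h : ∀ n ≥ n₀, ‖∑ i, z i ^ n‖ ≤ B) (i : ι) : ‖z i‖ ≤ 1 := by
  classical
  by_contra hlt
  push Not at hlt
  set Q : ℂ[X] := ∏ w ∈ (Finset.univ.image z).erase (z i), (X - C w) with hQ
  have hQi : Q.eval (z i) ≠ 0 := by
    rw [hQ, eval_prod, Finset.prod_ne_zero_iff]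
    intro w hw
    simp only [eval_sub, eval_X, eval_C]
    exact sub_ne_zero.mpr (Finset.ne_of_mem_erase hw).symm
  have hQj : ∀ j, z j ≠ z i → Q.eval (z j) = 0 := by
    intro j hj
    rw [hQ, eval_prod]
    refine Finset.prod_eq_zero (i := z j) (Finset.mem_erase.mpr ⟨hj, by simp⟩) (by simp)
  have key : ∀ n, ∑ l ∈ Finset.range (Q.natDegree + 1), Q.coeff l * ∑ j, z j ^ (n + l) =
      (Finset.univ.filter fun j => z j = z i).card * Q.eval (z i) * z i ^ n := by
    intro n
    have : ∀ j, z j ^ n * Q.eval (z j) = if z j = z i then Q.eval (z i) * z i ^ n else 0 := by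
      intro j
      split_ifs with hj
      · rw [hj]; ring
      · rw [hQj j hj]; ring
    calc _ = ∑ j, z j ^ n * Q.eval (z j) := by
          simp_rw [Finset.mul_sum]
          rw [Finset.sum_comm]
          refine Finset.sum_congr rfl fun j _ => ?_
          rw [eval_eq_sum_range, Finset.mul_sum]
          refine Finset.sum_congr rfl fun l _ => ?_
          rw [pow_add]; ring
      _ = _ := by
          simp_rw [this]
          rw [← Finset.sum_filter, Finset.sum_const, nsmul_eq_mul]; ring
  set A : ℝ := ∑ l ∈ Finset.range (Q.natDegree + 1), ‖Q.coeff l‖ * B with hA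
  set m : ℂ := (Finset.univ.filter fun j => z j = z i).card * Q.eval (z i) with hm
  have hm0 : m ≠ 0 := by
    refine mul_ne_zero ?_ hQi
    have : 0 < (Finset.univ.filter fun j => z j = z i).card :=
      Finset.card_pos.mpr ⟨i, by simp⟩
    exact_mod_cast this.ne'
  have hb : ∀ n ≥ n₀, ‖m‖ * ‖z i‖ ^ n ≤ A := by
    intro n hn
    rw [← norm_pow, ← norm_mul, ← key n]
    refine (norm_sum_le _ _).trans (Finset.sum_le_sum fun l _ => ?_)
    rw [norm_mul]
    exact mul_le_mul_of_nonneg_left (h _ (by omega)) (norm_nonneg _)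
  have ht := (tendsto_pow_atTop_atTop_of_one_lt hlt).const_mul_atTop (norm_pos_iff.mpr hm0)
  obtain ⟨n, hn1, hn2⟩ := ((ht.eventually_gt_atTop A).and (Filter.eventually_ge_atTop n₀)).exists
  exact absurd (hb n hn2) (not_le.mpr hn1)

section newton
variable {k : Type*} [Field k] [Finite k]

lemma monSet_finite (k : Type*) [Field k] [Finite k] (n : ℕ) : {f : k[X] | f.Monic ∧ f.natDegree = n}.Finite := by
  refine Set.Finite.of_injOn (f := fun f : k[X] => fun i : Fin (n+1) => f.coeff i) (t := Set.univ)
    (fun _ _ => Set.mem_univ _) ?_ Set.finite_univ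
  intro f hf g hg hfg
  ext i
  by_cases hi : i < n + 1
  · exact congrFun hfg ⟨i, hi⟩
  · rw [coeff_eq_zero_of_natDegree_lt (by have := hf.2; omega), coeff_eq_zero_of_natDegree_lt (by have := hg.2; omega)]

/-- monic polynomials of degree `n` -/
noncomputable def mon (k : Type*) [Field k] [Finite k] (n : ℕ) : Finset k[X] := (monSet_finite k n).toFinset

lemma mem_mon {n : ℕ} {f : k[X]} : f ∈ mon k n ↔ f.Monic ∧ f.natDegree = n := by
  simp [mon]

open Classical in
/-- monic irreducible polynomials of degree dividing `n` -/
noncomputable def irr (k : Type*) [Field k] [Finite k] (n : ℕ) : Finset k[X] :=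
  (n.divisors.biUnion (mon k)).filter Irreducible

lemma mem_irr {n : ℕ} (hn : n ≠ 0) {f : k[X]} :
    f ∈ irr k n ↔ f.Monic ∧ Irreducible f ∧ f.natDegree ∣ n := by
  simp only [irr, Finset.mem_filter, Finset.mem_biUnion, Nat.mem_divisors, mem_mon]
  constructor
  · rintro ⟨⟨d, ⟨h1, h2⟩, h3, rfl⟩, h5⟩; exact ⟨h3, h5, h1⟩
  · rintro ⟨h1, h2, h3⟩; exact ⟨⟨_, ⟨h3, hn⟩, h1, rfl⟩, h2⟩

open Classical in
lemma natDegree_eq_sum (f : k[X]) (n : ℕ) (hf : f ∈ mon k n) :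
    n = ∑ j ∈ Finset.Icc 1 n, ∑ P ∈ irr k j, if P ^ (j / P.natDegree) ∣ f then P.natDegree else 0 := by
  rw [mem_mon] at hf
  obtain ⟨hm, hdeg⟩ := hf
  have hf0 := hm.ne_zero
  set J : Finset k[X] := ((Finset.Icc 1 n).biUnion (mon k)).filter Irreducible with hJ
  have memJ : ∀ P, P ∈ J ↔ P.Monic ∧ Irreducible P ∧ 1 ≤ P.natDegree ∧ P.natDegree ≤ n := by
    intro P
    simp only [hJ, Finset.mem_filter, Finset.mem_biUnion, Finset.mem_Icc, mem_mon]
    constructor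
    · rintro ⟨⟨d, ⟨h1, h2⟩, h3, rfl⟩, h5⟩; exact ⟨h3, h5, h1, h2⟩
    · rintro ⟨h1, h2, h3⟩; exact ⟨⟨_, h3, h1, rfl⟩, h2⟩
  set W := UniqueFactorizationMonoid.normalizedFactors f with hW
  have hprod : W.prod = f := by
    have := UniqueFactorizationMonoid.prod_normalizedFactors_eq hf0
    rw [← hW] at this
    rw [this, hm.normalize_eq_self]
  have hWmon : ∀ P ∈ W, P.Monic := by
    intro P hP
    have h1 := UniqueFactorizationMonoid.normalize_normalized_factor P hP
    have h2 := (UniqueFactorizationMonoid.irreducible_of_normalized_factor P hP).ne_zero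
    rw [← h1]; exact monic_normalize h2
  have hWJ : W.toFinset ⊆ J := by
    intro P hP
    rw [Multiset.mem_toFinset] at hP
    rw [memJ]
    have hi := UniqueFactorizationMonoid.irreducible_of_normalized_factor P hP
    refine ⟨hWmon P hP, hi, ?_, ?_⟩
    · exact hi.natDegree_pos
    · rw [← hdeg]
      exact natDegree_le_of_dvd (UniqueFactorizationMonoid.dvd_of_mem_normalizedFactors hP) hf0
  have hcount : ∀ P ∈ J, ∀ j, P ^ j ∣ f ↔ j ≤ W.count P := by
    intro P hP j
    rw [memJ] at hP
    rw [pow_dvd_iff_le_emultiplicity,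
      UniqueFactorizationMonoid.emultiplicity_eq_count_normalizedFactors hP.2.1 hf0,
      hP.1.normalize_eq_self, ← hW]
    exact_mod_cast Iff.rfl
  have hn : n = ∑ P ∈ J, W.count P * P.natDegree := by
    calc n = (W.map natDegree).sum := by
          rw [← hdeg, ← hprod]
          exact natDegree_multiset_prod_of_monic W hWmon
      _ = ∑ P ∈ W.toFinset, W.count P * P.natDegree := by
          rw [Finset.sum_multiset_map_count]; simp
      _ = _ := by
          refine Finset.sum_subset hWJ fun P _ hP => ?_
          rw [Multiset.mem_toFinset] at hP
          rw [Multiset.count_eq_zero_of_notMem hP, zero_mul]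
  have hR : ∑ j ∈ Finset.Icc 1 n, ∑ P ∈ irr k j, (if P ^ (j / P.natDegree) ∣ f then P.natDegree else 0) =
      ∑ P ∈ J, ∑ j ∈ (Finset.Icc 1 n).filter (fun j => P.natDegree ∣ j),
        (if P ^ (j / P.natDegree) ∣ f then P.natDegree else 0) := by
    refine Finset.sum_comm' ?_
    intro j P
    rw [memJ, Finset.mem_filter, Finset.mem_Icc]
    constructor
    · rintro ⟨⟨h1, h2⟩, h3⟩
      rw [mem_irr (by omega)] at h3
      exact ⟨⟨⟨h1, h2⟩, h3.2.2⟩, h3.1, h3.2.1, h3.2.1.natDegree_pos,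
        (Nat.le_of_dvd (by omega) h3.2.2).trans h2⟩
    · rintro ⟨⟨⟨h1, h2⟩, h3⟩, h4, h5, -⟩
      rw [mem_irr (by omega)]
      exact ⟨⟨h1, h2⟩, h4, h5, h3⟩
  rw [hR]
  conv_lhs => rw [hn]
  refine Finset.sum_congr rfl fun P hP => ?_
  obtain ⟨hPm, hPi, hP1, hPn⟩ := (memJ P).mp hP
  rw [← Finset.sum_filter, Finset.sum_const, smul_eq_mul]
  congr 1
  rw [Finset.filter_filter]
  have hbound : W.count P * P.natDegree ≤ n := by
    have : P ^ W.count P ∣ f := (hcount P hP _).mpr le_rfl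
    have := natDegree_le_of_dvd this hf0
    rw [hPm.natDegree_pow] at this
    omega
  have : (Finset.Icc 1 n).filter (fun j => P.natDegree ∣ j ∧ P ^ (j / P.natDegree) ∣ f) =
      (Finset.Icc 1 (W.count P)).image (fun i => i * P.natDegree) := by
    ext j
    simp only [Finset.mem_filter, Finset.mem_Icc, Finset.mem_image]
    constructor
    · rintro ⟨⟨h1, h2⟩, ⟨i, rfl⟩, h3⟩
      rw [Nat.mul_div_cancel_left _ (by omega), hcount P hP] at h3
      exact ⟨i, ⟨Nat.pos_of_ne_zero (by rintro rfl; simp at h1), h3⟩, mul_comm _ _⟩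
    · rintro ⟨i, ⟨h1, h2⟩, rfl⟩
      refine ⟨⟨Nat.mul_pos h1 hP1, (Nat.mul_le_mul_right _ h2).trans hbound⟩, Dvd.intro_left _ rfl, ?_⟩
      rw [Nat.mul_div_cancel _ (by omega), hcount P hP]
      exact h2
  rw [this, Finset.card_image_of_injective, Nat.card_Icc, Nat.add_sub_cancel]
  intro a b hab
  exact Nat.eq_of_mul_eq_mul_right (by omega) hab

/-- power sums attached to a multiplicative function -/
noncomputable def psum (lam : k[X] → ℂ) (n : ℕ) : ℂ :=
  ∑ P ∈ irr k n, (P.natDegree : ℂ) * lam P ^ (n / P.natDegree)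

lemma newton_id (lam : k[X] → ℂ) (h1 : lam 1 = 1)
    (hmul : ∀ f g : k[X], f.Monic → g.Monic → lam (f * g) = lam f * lam g) (n : ℕ) :
    (n : ℂ) * ∑ f ∈ mon k n, lam f =
      ∑ j ∈ Finset.Icc 1 n, psum lam j * ∑ g ∈ mon k (n - j), lam g := by
  classical
  have hpow : ∀ (f : k[X]) (j : ℕ), f.Monic → lam (f ^ j) = lam f ^ j := by
    intro f j hf
    induction j with
    | zero => simp [h1]
    | succ j ih => rw [pow_succ, hmul _ _ (hf.pow j) hf, ih, pow_succ]
  rw [Finset.mul_sum]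
  have : ∀ f ∈ mon k n, (n : ℂ) * lam f = ∑ j ∈ Finset.Icc 1 n, ∑ P ∈ irr k j,
      if P ^ (j / P.natDegree) ∣ f then (P.natDegree : ℂ) * lam f else 0 := by
    intro f hf
    have h := congrArg (Nat.cast (R := ℂ)) (natDegree_eq_sum f n hf)
    rw [h]
    push_cast
    simp only [Finset.sum_mul, ite_mul, zero_mul]
  rw [Finset.sum_congr rfl this, Finset.sum_comm]
  refine Finset.sum_congr rfl fun j hj => ?_
  rw [Finset.mem_Icc] at hj
  rw [Finset.sum_comm, psum, Finset.sum_mul]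
  refine Finset.sum_congr rfl fun P hP => ?_
  rw [mem_irr (by omega)] at hP
  obtain ⟨hPm, hPi, hPd⟩ := hP
  rw [← Finset.sum_filter, Finset.mul_sum]
  have hdeg : (P ^ (j / P.natDegree)).natDegree = j := by
    rw [hPm.natDegree_pow, Nat.div_mul_cancel hPd]
  have hPj := hPm.pow (j / P.natDegree)
  symm
  refine Finset.sum_bij (fun g _ => P ^ (j / P.natDegree) * g) ?_ ?_ ?_ ?_
  · intro g hg
    rw [mem_mon] at hg
    rw [Finset.mem_filter, mem_mon]
    refine ⟨⟨hPj.mul hg.1, ?_⟩, Dvd.intro _ rfl⟩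
    rw [hPj.natDegree_mul hg.1, hdeg, hg.2]; omega
  · intro a _ b _ hab
    exact mul_left_cancel₀ hPj.ne_zero hab
  · intro f hf
    rw [Finset.mem_filter, mem_mon] at hf
    obtain ⟨⟨hf1, hf2⟩, g, rfl⟩ := hf
    have hg : g.Monic := hPj.of_mul_monic_left hf1
    refine ⟨g, ?_, rfl⟩
    rw [mem_mon]
    refine ⟨hg, ?_⟩
    rw [hPj.natDegree_mul hg, hdeg] at hf2
    omega
  · intro g hg
    rw [mem_mon] at hg
    rw [hmul _ _ hPj hg.1, hpow _ _ hPm]; ring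

/-- If the L-function is a polynomial of degree at most two, the power sums are power sums of two numbers. -/
lemma exists_roots (lam : k[X] → ℂ) (h1 : lam 1 = 1)
    (hmul : ∀ f g : k[X], f.Monic → g.Monic → lam (f * g) = lam f * lam g)
    (hvan : ∀ n ≥ 3, ∑ f ∈ mon k n, lam f = 0) :
    ∃ a b : ℂ, ∀ n ≥ 1, psum lam n = -(a ^ n + b ^ n) := by
  have hN := newton_id lam h1 hmul
  set L : ℕ → ℂ := fun n => ∑ f ∈ mon k n, lam f with hL
  have hL0 : L 0 = 1 := by
    have : mon k 0 = {1} := by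
      ext f
      rw [mem_mon, Finset.mem_singleton]
      constructor
      · rintro ⟨h, h'⟩; exact eq_one_of_monic_natDegree_zero h h'
      · rintro rfl; exact ⟨monic_one, natDegree_one⟩
    simp [hL, this, h1]
  obtain ⟨a, b, hs, hp⟩ : ∃ a b : ℂ, a + b = - L 1 ∧ a * b = L 2 := by
    obtain ⟨s, hs⟩ := IsAlgClosed.exists_pow_nat_eq (L 1 ^ 2 - 4 * L 2) (n := 2) (by norm_num)
    refine ⟨(- L 1 + s) / 2, (- L 1 - s) / 2, by ring, ?_⟩
    linear_combination (-1/4) * hs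
  refine ⟨a, b, ?_⟩
  intro n
  induction n using Nat.strong_induction_on with
  | _ n ih =>
    intro hn
    have h := hN n
    change (n : ℂ) * L n = ∑ j ∈ Finset.Icc 1 n, psum lam j * L (n - j) at h
    have hcase : n = 1 ∨ n = 2 ∨ ∃ m, n = m + 3 := by
      by_cases h3 : 3 ≤ n
      · exact Or.inr (Or.inr ⟨n - 3, by omega⟩)
      · omega
    rcases hcase with rfl | rfl | ⟨m, rfl⟩
    · simp [hL0] at h
      rw [← h]; linear_combination hs
    · rw [Finset.sum_Icc_succ_top (by norm_num)] at h
      simp [hL0] at h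
      rw [ih 1 (by norm_num) le_rfl] at h
      linear_combination -h - 2 * hp + (a + b) * hs
    · have hLv : ∀ i ≥ 3, L i = 0 := hvan
      rw [hLv _ (by omega), Finset.sum_Icc_succ_top (by omega), Finset.sum_Icc_succ_top (by omega)] at h
      have e1 : m + 3 - (m + 1 + 1) = 1 := by omega
      have e2 : m + 3 - (m + 2 + 1) = 0 := by omega
      rw [e1, e2, hL0, ih (m + 1 + 1) (by omega) (by omega)] at h
      rcases Nat.eq_zero_or_pos m with rfl | hm
      · simp at h
        rw [ih 1 (by norm_num) le_rfl] at h
        linear_combination -h + (a ^ 2 + b ^ 2) * hs - (a + b) * hp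
      · rw [Finset.sum_Icc_succ_top (by omega), Finset.sum_eq_zero] at h
        · have e3 : m + 3 - (m + 1) = 2 := by omega
          rw [e3, ih (m + 1) (by omega) (by omega)] at h
          linear_combination -h + (a ^ (m+2) + b ^ (m+2)) * hs - (a ^ (m+1) + b^(m+1)) * hp
        · intro j hj
          rw [Finset.mem_Icc] at hj
          rw [hLv _ (by omega), mul_zero]

/-- Power sums as sums over the extension of degree `n`. -/
lemma psum_eq (lam : k[X] → ℂ) (E : Type*) [Field E] [Fintype E] [Algebra k E] (n : ℕ)
    (hn : Module.finrank k E = n) :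
    psum lam n = ∑ b : E, lam (minpoly k b) ^ (n / (minpoly k b).natDegree) := by
  classical
  have : Module.Finite k E := inferInstance
  have hn0 : n ≠ 0 := by rw [← hn]; exact Module.finrank_pos.ne'
  have hintg : ∀ b : E, IsIntegral k b := fun b => Algebra.IsIntegral.isIntegral b
  rw [← Finset.sum_fiberwise_of_maps_to (s := (Finset.univ : Finset E)) (t := irr k n) (g := fun b => minpoly k b)]
  · rw [psum]
    refine Finset.sum_congr rfl fun P hP => ?_
    rw [mem_irr hn0] at hP
    obtain ⟨hPm, hPi, hPd⟩ := hP
    rw [Finset.sum_congr rfl (g := fun _ => lam P ^ (n / P.natDegree))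
      (fun b hb => by rw [(Finset.mem_filter.mp hb).2]), Finset.sum_const, nsmul_eq_mul]
    congr 2
    have hsep : P.Separable := PerfectField.separable_of_irreducible hPi
    have hsplit : (P.map (algebraMap k E)).Splits := by
      have hdvd := (hPi.natDegree_dvd_iff_dvd_X_pow_card_pow_sub_X (n := n)).mp hPd
      have hcard : Nat.card k ^ n = Fintype.card E := by
        rw [← hn, ← Module.natCard_eq_pow_finrank (K := k) (V := E), Nat.card_eq_fintype_card]
      rw [hcard] at hdvd
      have hne : ((X ^ Fintype.card E - X : k[X]).map (algebraMap k E)) ≠ 0 := by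
        refine map_ne_zero (FiniteField.X_pow_card_sub_X_ne_zero k Fintype.one_lt_card)
      exact ((FiniteField.isSplittingField_sub E k).splits).of_dvd hne (map_dvd (algebraMap k E) hdvd)
    have hc := card_rootSet_eq_natDegree hsep hsplit
    rw [← hc, ← Set.toFinset_card]
    congr 1
    ext b
    simp only [Set.mem_toFinset, mem_rootSet, Finset.mem_filter, Finset.mem_univ, true_and]
    constructor
    · rintro ⟨_, h⟩
      exact (minpoly.eq_of_irreducible_of_monic hPi h hPm).symm
    · intro h
      exact ⟨hPm.ne_zero, by rw [← h]; exact minpoly.aeval k b⟩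
  · intro b _
    rw [mem_irr hn0]
    refine ⟨minpoly.monic (hintg b), minpoly.irreducible (hintg b), ?_⟩
    rw [← hn]
    exact minpoly.degree_dvd (hintg b)
end newton


lemma eta_cube {E : Type*} [Field E] [Fintype E] (η : E →* ℂ)
    (h3 : ∀ x, x ≠ 0 → η x ^ 3 = 1) (hne : ∃ x, x ≠ 0 ∧ η x ≠ 1) (x : E) (hx : x ≠ 0) (h : η x = 1) :
    ∃ w : E, w ≠ 0 ∧ w ^ 3 = x := by
  obtain ⟨g, hg⟩ := IsCyclic.exists_generator (α := Eˣ)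
  have hg1 : η g ≠ 1 := by
    intro h1
    obtain ⟨y, hy, hy1⟩ := hne
    obtain ⟨i, hi⟩ := Subgroup.mem_zpowers_iff.mp (hg (Units.mk0 y hy))
    apply hy1
    have : ((Units.map η) (g ^ i) : ℂ) = η y := by rw [hi]; rfl
    rw [← this, map_zpow]
    have : Units.map η g = 1 := Units.ext h1
    rw [this]; simp
  obtain ⟨i, hi⟩ := (mem_powers_iff_mem_zpowers (x := g)).mpr (hg (Units.mk0 x hx))
  have hi : g ^ i = Units.mk0 x hx := hi
  have hxi : x = (g : E) ^ i := by rw [← Units.val_pow_eq_pow_val, hi]; rfl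
  have hord : orderOf (η g) = 3 := orderOf_eq_prime (h3 _ g.ne_zero) hg1
  have : 3 ∣ i := by
    rw [← hord]
    apply orderOf_dvd_of_pow_eq_one
    rw [← map_pow, ← hxi, h]
  obtain ⟨j, rfl⟩ := this
  exact ⟨(g : E) ^ j, pow_ne_zero _ g.ne_zero, by rw [hxi, ← pow_mul, mul_comm]⟩

lemma char_sum_bound {E : Type*} [Field E] [Fintype E] (ℓ m e D : ℕ)
    [Fact ℓ.Prime] [CharP E ℓ]
    (hq : ℓ ^ m = 3 * e + 1) (hcard : Fintype.card E = (ℓ ^ m) ^ 2)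
    (h : E[X]) (hD : h.natDegree = D) (hD3 : ¬ 3 ∣ D) (he : 3 * D + 1 ≤ e)
    (η : E →* ℂ) (h0 : η 0 = 0)
    (h3 : ∀ x, x ≠ 0 → η x ^ 3 = 1) (hne : ∃ x, x ≠ 0 ∧ η x ≠ 1) :
    ‖∑ v : E, η (h.eval v)‖ ≤ 3 * D + 2 * (5 * D + 1) * (ℓ : ℝ) ^ m := by
  classical
  have hh : h ≠ 0 := by rintro rfl; simp at hD; subst hD; simp at hD3
  obtain ⟨g, hg0, hg1⟩ := hne
  set ω := η g with hω
  have hω3 : ω ^ 3 = 1 := h3 g hg0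
  have hωs : 1 + ω + ω ^ 2 = 0 := by
    have : (ω - 1) * (1 + ω + ω ^ 2) = 0 := by ring_nf; rw [hω3]; ring
    exact (mul_eq_zero.mp this).resolve_left (sub_ne_zero.mpr hg1)
  set T : ℕ → Finset E := fun j => Finset.univ.filter fun v => h.eval v ≠ 0 ∧ η (h.eval v) = ω ^ j with hT
  have hTb : ∀ j, j < 3 → 3 * (T j).card ≤ (ℓ ^ m) ^ 2 + (5 * D + 1) * ℓ ^ m := by
    intro j hj
    refine stepanov_bound ℓ m e D hq hcard (C (g ^ (3 - j)) * h) ?_ hD3 he (T j) ?_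
    · rw [natDegree_C_mul (pow_ne_zero _ hg0), hD]
    · intro v hv
      simp only [hT, Finset.mem_filter, Finset.mem_univ, true_and] at hv
      rw [eval_mul, eval_C]
      refine eta_cube η h3 ⟨g, hg0, hg1⟩ _ (mul_ne_zero (pow_ne_zero _ hg0) hv.1) ?_
      rw [map_mul, map_pow, hv.2, ← hω, ← pow_add, Nat.sub_add_cancel hj.le, hω3]
  have hω0 : ω ≠ 0 := by intro h; rw [h] at hω3; simp at hω3
  have hω2 : ω ^ 2 ≠ 1 := by
    intro h; apply hg1
    have : ω ^ 3 = ω := by rw [pow_succ, h, one_mul]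
    rw [← this, hω3]
  have hω12 : ω ≠ ω ^ 2 := by
    intro h; apply hg1
    have : ω * ω = ω * 1 := by rw [← sq, ← h, mul_one]
    exact mul_left_cancel₀ hω0 this
  have hcase : ∀ x : E, x ≠ 0 → η x = 1 ∨ η x = ω ∨ η x = ω ^ 2 := by
    intro x hx
    have e1 : (η x - 1) * ((η x - ω) * (η x - ω ^ 2)) = 0 := by
      have := h3 x hx
      have e2 : (η x - 1) * ((η x - ω) * (η x - ω ^ 2)) = η x ^ 3 - ω ^ 3 := by
        linear_combination (-(η x) ^ 2 + (η x) * ω ) * hωs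
      rw [e2, this, hω3, sub_self]
    rcases mul_eq_zero.mp e1 with h | h
    · exact Or.inl (sub_eq_zero.mp h)
    · rcases mul_eq_zero.mp h with h | h
      · exact Or.inr (Or.inl (sub_eq_zero.mp h))
      · exact Or.inr (Or.inr (sub_eq_zero.mp h))
  have hval : ∀ v : E, η (h.eval v) = (if v ∈ T 0 then 1 else 0) + (if v ∈ T 1 then ω else 0) +
      (if v ∈ T 2 then ω ^ 2 else 0) := by
    intro v
    by_cases hv : h.eval v = 0
    · simp [hT, hv, h0]
    · simp only [hT, Finset.mem_filter, Finset.mem_univ, true_and, ne_eq, hv, not_false_eq_true,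
        pow_zero, pow_one]
      rcases hcase _ hv with h | h | h <;> rw [h]
      · simp [Ne.symm hg1, Ne.symm hω2]
      · simp [hg1, hω12]
      · simp [hω2, Ne.symm hω12]
  have hsum : ∑ v : E, η (h.eval v) = (T 0).card + (T 1).card * ω + (T 2).card * ω ^ 2 := by
    simp_rw [hval]
    rw [Finset.sum_add_distrib, Finset.sum_add_distrib]
    simp
  have htot : Fintype.card E ≤ (T 0).card + (T 1).card + (T 2).card + D := by
    have hsub : (Finset.univ : Finset E) ⊆ ((T 0 ∪ T 1) ∪ T 2) ∪ h.roots.toFinset := by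
      intro v _
      by_cases hv : h.eval v = 0
      · refine Finset.mem_union_right _ ?_
        rw [Multiset.mem_toFinset, mem_roots hh]; exact hv
      · refine Finset.mem_union_left _ ?_
        simp only [hT, Finset.mem_union, Finset.mem_filter, Finset.mem_univ, true_and, ne_eq, hv,
          not_false_eq_true, pow_zero, pow_one]
        rcases hcase _ hv with h | h | h
        · exact Or.inl (Or.inl h)
        · exact Or.inl (Or.inr h)
        · exact Or.inr h
    have h1 := Finset.card_le_card hsub
    rw [Finset.card_univ] at h1
    have h2 := Finset.card_union_le ((T 0 ∪ T 1) ∪ T 2) h.roots.toFinset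
    have h3 := Finset.card_union_le (T 0 ∪ T 1) (T 2)
    have h4 := Finset.card_union_le (T 0) (T 1)
    have h5 := (Multiset.toFinset_card_le h.roots).trans (card_roots' h)
    omega
  have b0 := hTb 0 (by norm_num)
  have b1 := hTb 1 (by norm_num)
  have b2 := hTb 2 (by norm_num)
  rw [hcard] at htot
  have nω : ‖ω‖ = 1 := by
    have : ‖ω‖ ^ 3 = 1 := by rw [← norm_pow, hω3, norm_one]
    exact (pow_eq_one_iff_of_nonneg (norm_nonneg _) (by norm_num)).mp this
  have hqR : (((ℓ ^ m : ℕ) : ℝ)) = (ℓ : ℝ) ^ m := by push_cast; rfl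
  rw [← hqR]
  generalize ℓ ^ m = Q at *
  generalize (T 0).card = n0 at *
  generalize (T 1).card = n1 at *
  generalize (T 2).card = n2 at *
  have c0 : (3 : ℝ) * n0 ≤ Q ^ 2 + (5 * D + 1) * Q := by exact_mod_cast b0
  have c1 : (3 : ℝ) * n1 ≤ Q ^ 2 + (5 * D + 1) * Q := by exact_mod_cast b1
  have c2 : (3 : ℝ) * n2 ≤ Q ^ 2 + (5 * D + 1) * Q := by exact_mod_cast b2
  have ct : (Q : ℝ) ^ 2 ≤ n0 + n1 + n2 + D := by exact_mod_cast htot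
  have hDnn : (0 : ℝ) ≤ D := Nat.cast_nonneg _
  have hQnn : (0 : ℝ) ≤ (5 * D + 1) * Q := by positivity
  have hs : (n0 : ℂ) + n1 * ω + n2 * ω ^ 2 = (((n0 : ℝ) - Q ^ 2 / 3 : ℝ) : ℂ) + (((n1 : ℝ) - Q ^ 2 / 3 : ℝ) : ℂ) * ω
      + (((n2 : ℝ) - Q ^ 2 / 3 : ℝ) : ℂ) * ω ^ 2 := by
    push_cast
    linear_combination ((Q : ℂ) ^ 2 / 3) * hωs
  rw [hsum, hs]
  refine (norm_add₃_le).trans ?_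
  rw [norm_mul, norm_mul, norm_pow, nω, Complex.norm_real, Complex.norm_real, Complex.norm_real]
  simp only [Real.norm_eq_abs, one_pow, mul_one]
  have a0 : |(n0 : ℝ) - Q ^ 2 / 3| ≤ (D : ℝ) + 2 * ((5 * (D : ℝ) + 1) * Q) / 3 := abs_le.mpr ⟨by linarith, by linarith⟩
  have a1 : |(n1 : ℝ) - Q ^ 2 / 3| ≤ (D : ℝ) + 2 * ((5 * (D : ℝ) + 1) * Q) / 3 := abs_le.mpr ⟨by linarith, by linarith⟩
  have a2 : |(n2 : ℝ) - Q ^ 2 / 3| ≤ (D : ℝ) + 2 * ((5 * (D : ℝ) + 1) * Q) / 3 := abs_le.mpr ⟨by linarith, by linarith⟩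
  linarith

/-- Artin–Schreier: sums over trace zero elements. -/
lemma trace_zero_sum (p : ℕ) [Fact p.Prime] {E : Type*} [Field E] [Fintype E] [DecidableEq E] [Algebra (ZMod p) E]
    (g : E → ℂ) :
    ∑ y : E, g (y ^ p - y) = p * ∑ b : E with Algebra.trace (ZMod p) E b = 0, g b := by
  have hpp := (Fact.out : p.Prime)
  have : CharP E p := charP_of_injective_algebraMap (algebraMap (ZMod p) E).injective p
  let wp : E →ₗ[ZMod p] E := (AddMonoidHom.toZModLinearMap p
    ({ toFun := fun y => y ^ p - y, map_zero' := by simp [hpp.ne_zero],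
       map_add' := fun x y => by rw [add_pow_char]; ring } : E →+ E))
  have hwp : ∀ y, wp y = y ^ p - y := fun y => rfl
  have hker : ∀ y : E, y ^ p = y ↔ ∃ a : ZMod p, algebraMap (ZMod p) E a = y := by
    have hsub : (Finset.univ.image (algebraMap (ZMod p) E)) ⊆ (X ^ p - X : E[X]).roots.toFinset := by
      intro y hy
      obtain ⟨a, -, rfl⟩ := Finset.mem_image.mp hy
      rw [Multiset.mem_toFinset, mem_roots (FiniteField.X_pow_card_sub_X_ne_zero E hpp.one_lt)]
      simp [← map_pow, ZMod.pow_card]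
    have hcard : (X ^ p - X : E[X]).roots.toFinset.card ≤ (Finset.univ.image (algebraMap (ZMod p) E)).card := by
      rw [Finset.card_image_of_injective _ (algebraMap (ZMod p) E).injective, Finset.card_univ, ZMod.card]
      refine (Multiset.toFinset_card_le _).trans ((card_roots' _).trans ?_)
      rw [FiniteField.X_pow_card_sub_X_natDegree_eq E hpp.one_lt]
    have heq := Finset.eq_of_subset_of_card_le hsub hcard
    intro y
    have : y ∈ (Finset.univ.image (algebraMap (ZMod p) E)) ↔ y ∈ (X ^ p - X : E[X]).roots.toFinset := by rw [heq]
    rw [Multiset.mem_toFinset, mem_roots (FiniteField.X_pow_card_sub_X_ne_zero E hpp.one_lt)] at this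
    simp only [Finset.mem_image, Finset.mem_univ, true_and, IsRoot.def, eval_sub, eval_pow, eval_X, sub_eq_zero] at this
    exact this.symm
  have hkdim : Module.finrank (ZMod p) (LinearMap.ker wp) = 1 := by
    have : LinearMap.ker wp = Submodule.span (ZMod p) {(1 : E)} := by
      ext y
      rw [LinearMap.mem_ker, hwp, sub_eq_zero, hker, Submodule.mem_span_singleton]
      simp [Algebra.smul_def]
    rw [this, finrank_span_singleton one_ne_zero]
  have htr : ∀ y, Algebra.trace (ZMod p) E (y ^ p) = Algebra.trace (ZMod p) E y := by
    intro y
    have := Algebra.trace_eq_of_algEquiv (FiniteField.frobeniusAlgEquivOfAlgebraic (ZMod p) E) y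
    simpa using this
  have hle : LinearMap.range wp ≤ LinearMap.ker (Algebra.trace (ZMod p) E) := by
    rintro _ ⟨y, rfl⟩
    rw [LinearMap.mem_ker, hwp, map_sub, htr, sub_self]
  have hrange : LinearMap.range wp = LinearMap.ker (Algebra.trace (ZMod p) E) := by
    refine Submodule.eq_of_le_of_finrank_eq hle ?_
    have r1 := LinearMap.finrank_range_add_finrank_ker wp
    have r2 := LinearMap.finrank_range_add_finrank_ker (Algebra.trace (ZMod p) E)
    rw [LinearMap.range_eq_top.mpr (Algebra.trace_surjective (ZMod p) E), finrank_top, Module.finrank_self] at r2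
    omega
  rw [← Finset.sum_fiberwise_of_maps_to (s := (Finset.univ : Finset E))
    (t := Finset.univ.filter fun b : E => Algebra.trace (ZMod p) E b = 0) (g := fun y => y ^ p - y)]
  · rw [Finset.mul_sum]
    refine Finset.sum_congr rfl fun b hb => ?_
    have hb : Algebra.trace (ZMod p) E b = 0 := (Finset.mem_filter.mp hb).2
    rw [← LinearMap.mem_ker, ← hrange] at hb
    obtain ⟨y₀, hy₀⟩ := hb
    rw [hwp] at hy₀
    rw [Finset.sum_congr rfl (g := fun _ => g b) (fun y hy => by rw [(Finset.mem_filter.mp hy).2]),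
      Finset.sum_const, nsmul_eq_mul]
    congr 2
    have : (Finset.univ.filter fun y : E => y ^ p - y = b) =
        Finset.univ.image (fun a : ZMod p => y₀ + algebraMap (ZMod p) E a) := by
      ext y
      simp only [Finset.mem_filter, Finset.mem_univ, true_and, Finset.mem_image]
      have : y ^ p - y = b ↔ (y - y₀) ^ p = y - y₀ := by
        rw [sub_pow_char, ← hy₀]
        constructor
        · intro h; linear_combination h
        · intro h; linear_combination h
      rw [this, hker]
      constructor
      · rintro ⟨a, ha⟩; exact ⟨a, by rw [ha]; ring⟩
      · rintro ⟨a, ha⟩; exact ⟨a, by rw [← ha]; ring⟩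
    rw [this, Finset.card_image_of_injective, Finset.card_univ, ZMod.card]
    intro a b hab
    exact (algebraMap (ZMod p) E).injective (add_left_cancel hab)
  · intro y _
    rw [Finset.mem_filter]
    refine ⟨Finset.mem_univ _, ?_⟩
    rw [map_sub, htr, sub_self]


lemma prod_range_periodic {M : Type*} [CommMonoid M] (f : ℕ → M) (d : ℕ) (hf : ∀ i, f (i + d) = f i) (m : ℕ) :
    ∏ i ∈ Finset.range (d * m), f i = (∏ i ∈ Finset.range d, f i) ^ m := by
  have hf' : ∀ m i, f (d * m + i) = f i := by
    intro m i
    induction m with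
    | zero => simp
    | succ m ih => rw [← ih, ← hf (d * m + i)]; congr 1; ring
  induction m with
  | zero => simp
  | succ m ih =>
    rw [mul_add, mul_one, Finset.prod_range_add, ih, pow_succ]
    congr 1
    exact Finset.prod_congr rfl fun i _ => hf' m i

lemma minpoly_eval_frob (p : ℕ) [Fact p.Prime] {E : Type*} [Field E] [Fintype E] [Algebra (ZMod p) E]
    (b x : E) :
    aeval x (minpoly (ZMod p) b) ^ (Module.finrank (ZMod p) E / (minpoly (ZMod p) b).natDegree) =
      ∏ i ∈ Finset.range (Module.finrank (ZMod p) E), (x - b ^ p ^ i) := by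
  have hpp := (Fact.out : p.Prime)
  have : CharP E p := charP_of_injective_algebraMap (algebraMap (ZMod p) E).injective p
  set P := minpoly (ZMod p) b with hP
  set d := P.natDegree with hd
  have hintg : IsIntegral (ZMod p) b := IsIntegral.of_finite _ _
  have hirr : Irreducible P := minpoly.irreducible hintg
  have hmon : P.Monic := minpoly.monic hintg
  have hper : ∀ j, b ^ p ^ j = b ↔ d ∣ j := by
    intro j
    have := hirr.natDegree_dvd_iff_dvd_X_pow_card_pow_sub_X (n := j)
    rw [hd, this, Nat.card_zmod, hP, minpoly.dvd_iff]
    simp [sub_eq_zero]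
  have hdist : ∀ i j, i < d → j < d → b ^ p ^ i = b ^ p ^ j → i = j := by
    have : ∀ i j, i < j → j < d → b ^ p ^ i ≠ b ^ p ^ j := by
      intro i j hij hj h
      obtain ⟨k, rfl⟩ := Nat.exists_eq_add_of_lt hij
      have e : b ^ p ^ (i + k + 1) = (b ^ p ^ (k + 1)) ^ p ^ i := by
        rw [← pow_mul, ← pow_add]; congr 2; ring
      rw [e, ← iterateFrobenius_def (R := E) p i, ← iterateFrobenius_def (R := E) p i] at h
      have h := (iterateFrobenius E p i).injective h
      have := Nat.le_of_dvd (by omega) ((hper (k + 1)).mp h.symm)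
      omega
    intro i j hi hj h
    rcases lt_trichotomy i j with h' | h' | h'
    · exact absurd h (this i j h' hj)
    · exact h'
    · exact absurd h.symm (this j i h' hi)
  have hPmap : P.map (algebraMap (ZMod p) E) = ∏ i ∈ Finset.range d, (X - C (b ^ p ^ i)) := by
    refine eq_of_monic_of_dvd_of_natDegree_le (monic_prod_X_sub_C _ _) (hmon.map _) ?_ ?_
    · refine Finset.prod_dvd_of_coprime ?_ ?_
      · intro i hi j hj hij
        refine isCoprime_X_sub_C_of_isUnit_sub (IsUnit.mk0 _ (sub_ne_zero.mpr ?_))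
        intro h
        exact hij (hdist i j (by simpa using hi) (by simpa using hj) h)
      · intro i _
        rw [dvd_iff_isRoot, IsRoot.def, eval_map_algebraMap]
        induction i with
        | zero => rw [pow_zero, pow_one]; exact minpoly.aeval _ _
        | succ i ih =>
          have ih := ih (by simp at *; omega)
          rw [pow_succ, pow_mul, ← expand_aeval, ZMod.expand_card, map_pow, ih, zero_pow hpp.ne_zero]
    · rw [natDegree_prod_of_monic _ _ (fun i _ => monic_X_sub_C _), natDegree_map]
      simp only [natDegree_X_sub_C, Finset.sum_const, Finset.card_range, smul_eq_mul, mul_one]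
      exact hd.ge
  have hdvd : d ∣ Module.finrank (ZMod p) E := minpoly.degree_dvd hintg
  obtain ⟨m, hm⟩ := hdvd
  have hdpos : 0 < d := hirr.natDegree_pos
  rw [hm, Nat.mul_div_cancel_left _ hdpos, prod_range_periodic]
  · congr 1
    rw [← eval_map_algebraMap, hPmap, eval_prod]
    simp
  · intro i
    rw [pow_add, mul_comm, pow_mul, (hper d).mpr dvd_rfl]

lemma prod_range_two_mul {M : Type*} [CommMonoid M] (f : ℕ → M) (m : ℕ) :
    ∏ i ∈ Finset.range (2 * m), f i = ∏ i ∈ Finset.range m, (f (2 * i) * f (2 * i + 1)) := by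
  induction m with
  | zero => simp
  | succ m ih => rw [mul_add, mul_one, Finset.prod_range_succ, Finset.prod_range_succ, ih,
      Finset.prod_range_succ, mul_assoc]

lemma minpoly_theta (p : ℕ) [Fact p.Prime] {F E : Type*} [Field F] [Fintype F] [Field E] [Fintype E]
    [Algebra (ZMod p) F] [Algebra (ZMod p) E] [Algebra F E] [IsScalarTower (ZMod p) F E]
    (hodd : Odd p) (hF : Module.finrank (ZMod p) F = 2) (θ : F) (hθ : θ ^ p = -θ) (b : E) :
    aeval θ (minpoly (ZMod p) b) ^ (Module.finrank (ZMod p) E / (minpoly (ZMod p) b).natDegree) =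
      Algebra.norm F (-((algebraMap F E θ - b) * (algebraMap F E θ + b) ^ p)) := by
  have hpp := (Fact.out : p.Prime)
  have : CharP E p := charP_of_injective_algebraMap (algebraMap (ZMod p) E).injective p
  have hcF : Fintype.card F = p ^ 2 := by
    rw [← hF, Module.card_eq_pow_finrank (K := ZMod p), ZMod.card]
  apply (algebraMap F E).injective
  rw [map_pow, ← aeval_algebraMap_apply, minpoly_eval_frob, ← Module.finrank_mul_finrank (ZMod p) F E, hF,
    prod_range_two_mul, FiniteField.algebraMap_norm_eq_prod_pow, Nat.card_eq_fintype_card, hcF]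
  refine Finset.prod_congr rfl fun i _ => ?_
  set t := algebraMap F E θ with ht
  have htp : t ^ p = -t := by rw [ht, ← map_pow, hθ, map_neg]
  have ht2 : t ^ p ^ 2 = t := by
    rw [pow_two, pow_mul, htp, hodd.neg_pow, htp, neg_neg]
  have hti : ∀ i : ℕ, t ^ (p ^ 2) ^ i = t := by
    intro i
    induction i with
    | zero => simp
    | succ i ih => rw [pow_succ, pow_mul, ih, ht2]
  have ho : Odd ((p ^ 2) ^ i) := (hodd.pow).pow
  rw [ho.neg_pow, mul_pow, add_pow_char, htp, ← pow_mul p 2 i, sub_pow_char_pow, add_pow_char_pow,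
    (hodd.pow).neg_pow, pow_mul, hti, ← pow_mul b p, ← pow_mul p 2 i, ← pow_succ']
  ring

lemma eta_minpoly (p : ℕ) [Fact p.Prime] {F E : Type*} [Field F] [Fintype F] [Field E] [Fintype E]
    [Algebra (ZMod p) F] [Algebra (ZMod p) E] [Algebra F E] [IsScalarTower (ZMod p) F E]
    (hodd : Odd p) (hp3 : p % 3 = 2)
    (hF : Module.finrank (ZMod p) F = 2) (θ : F) (hθ : θ ^ p = -θ)
    (χ : F →* ℂ) (η : E →* ℂ) (hη : ∀ x, η x = χ (Algebra.norm F x))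
    (h0 : η 0 = 0) (h3 : ∀ x, x ≠ 0 → η x ^ 3 = 1) (b : E) :
    χ (aeval θ (minpoly (ZMod p) b)) ^ (Module.finrank (ZMod p) E / (minpoly (ZMod p) b).natDegree) =
      η ((algebraMap F E θ - b) * (algebraMap F E θ + b) ^ 2) := by
  rw [← map_pow, minpoly_theta p hodd hF θ hθ, ← hη]
  have hm1 : η (-1) = 1 := by
    rw [← h3 (-1) (by simp), ← map_pow]; norm_num
  have hp : ∀ y, η y ^ p = η y ^ 2 := by
    intro y
    by_cases hy : y = 0
    · rw [hy, h0, zero_pow (by omega), zero_pow (by omega)]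
    · rw [← Nat.div_add_mod p 3, hp3, pow_add, pow_mul, h3 y hy, one_pow, one_mul]
  rw [neg_eq_neg_one_mul, map_mul, hm1, one_mul, map_mul, map_mul, map_pow, map_pow, hp]

lemma psi_minpoly (p : ℕ) [Fact p.Prime] {E : Type*} [Field E] [Fintype E]
    [Algebra (ZMod p) E] (ψ : AddChar (ZMod p) ℂ) (c : ZMod p) (b : E) :
    ψ (c * (minpoly (ZMod p) b).nextCoeff) ^ (Module.finrank (ZMod p) E / (minpoly (ZMod p) b).natDegree)
     = ψ (- (c * Algebra.trace (ZMod p) E b)) := by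
  have hintg : IsIntegral (ZMod p) b := IsIntegral.of_finite _ _
  rw [trace_eq_finrank_mul_minpoly_nextCoeff, ← AddChar.map_nsmul_eq_pow]
  have h1 : Module.finrank (ZMod p) E / (minpoly (ZMod p) b).natDegree =
      Module.finrank (IntermediateField.adjoin (ZMod p) {b}) E := by
    rw [← Module.finrank_mul_finrank (ZMod p) (IntermediateField.adjoin (ZMod p) {b}) E,
      IntermediateField.adjoin.finrank hintg, Nat.mul_div_cancel_left _ (minpoly.natDegree_pos hintg)]
  rw [h1, nsmul_eq_mul]
  congr 1; ring


lemma as_sum_bound (p : ℕ) [Fact p.Prime] {E : Type*} [Field E] [Fintype E] [CharP E p]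
    (hodd : Odd p) (hp3 : p % 3 = 2) (t : E) (ht0 : t ≠ 0) (ht : t ^ p = -t) (m e : ℕ)
    (hq : p ^ m = 3 * e + 1) (hcard : Fintype.card E = (p ^ m) ^ 2)
    (he : 3 * (3 * p - 1) + 1 ≤ e)
    (η : E →* ℂ) (h0 : η 0 = 0)
    (h3 : ∀ x, x ≠ 0 → η x ^ 3 = 1) (hne : ∃ x, x ≠ 0 ∧ η x ≠ 1) :
    ‖∑ y : E, η ((t - (y ^ p - y)) * (t + (y ^ p - y)) ^ 2)‖ ≤
      1 + (3 * (3 * p - 1 : ℕ) + 2 * (5 * (3 * p - 1 : ℕ) + 1) * (p : ℝ) ^ m) := by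
  classical
  have hpp := (Fact.out : p.Prime)
  have hp1 : 1 < p := hpp.one_lt
  have h2 : (2 : E) ≠ 0 := by
    have := (CharP.cast_eq_zero_iff E p 2).not.mpr (by
      intro h; have := (Nat.prime_dvd_prime_iff_eq hpp Nat.prime_two).mp h; subst this
      exact absurd hodd (by decide))
    exact_mod_cast this
  have h2p : (2 : E) ^ p = 2 := by
    have : (1 + 1 : E) ^ p = 1 + 1 := by rw [add_pow_char, one_pow]
    rwa [one_add_one_eq_two] at this
  set A : E[X] := 1 - X ^ (p - 1) with hA
  set B : E[X] := 1 - X ^ (p - 1) + C (2 * t) * X ^ p with hB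
  have dA : A.natDegree = p - 1 := by
    rw [hA, natDegree_sub_eq_right_of_natDegree_lt, natDegree_X_pow]
    rw [natDegree_one, natDegree_X_pow]; omega
  have dB : B.natDegree = p := by
    have e := natDegree_C_mul_X_pow p (2 * t) (mul_ne_zero h2 ht0)
    rw [hB, ← hA, natDegree_add_eq_right_of_natDegree_lt, e]
    rw [dA, e]; omega
  have hA0 : A ≠ 0 := by intro h; rw [h] at dA; simp at dA; omega
  have hB0 : B ≠ 0 := by intro h; rw [h] at dB; simp at dB; omega
  have dh : (A * B ^ 2).natDegree = 3 * p - 1 := by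
    rw [natDegree_mul hA0 (pow_ne_zero _ hB0), natDegree_pow, dA, dB]; omega
  have hb := char_sum_bound p m e (3 * p - 1) hq hcard (A * B ^ 2) dh (by omega) he η h0 h3 hne
  set y0 : E := -t / 2 with hy0
  have hy : y0 ^ p - y0 = t := by
    rw [hy0, div_pow, h2p, hodd.neg_pow, ht]; field_simp; ring
  have key : ∀ v : E, η ((t - ((y0 + v⁻¹) ^ p - (y0 + v⁻¹))) * (t + ((y0 + v⁻¹) ^ p - (y0 + v⁻¹))) ^ 2) =
      η ((A * B ^ 2).eval v) - if v = 0 then 1 else 0 := by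
    intro v
    rw [add_pow_char]
    have e1 : y0 ^ p + v⁻¹ ^ p - (y0 + v⁻¹) = t + (v⁻¹ ^ p - v⁻¹) := by linear_combination hy
    rw [e1]
    by_cases hv : v = 0
    · subst hv
      have hz : (0 : E) ^ (p - 1) = 0 := zero_pow (by omega)
      simp [hpp.ne_zero, h0, hA, hB, hz]
    · rw [if_neg hv, sub_zero]
      have e2 : (t - (t + (v⁻¹ ^ p - v⁻¹))) * (t + (t + (v⁻¹ ^ p - v⁻¹))) ^ 2 =
          (-(v⁻¹) ^ p) ^ 3 * ((A * B ^ 2).eval v) := by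
        have e3 : v⁻¹ ^ p * v ^ (p - 1) = v⁻¹ := by
          obtain ⟨k, rfl⟩ : ∃ k, p = k + 1 := ⟨p - 1, by omega⟩
          rw [Nat.add_sub_cancel, pow_succ, mul_right_comm, ← mul_pow, inv_mul_cancel₀ hv, one_pow, one_mul]
        have e4 : v⁻¹ ^ p * v ^ p = 1 := by rw [← mul_pow, inv_mul_cancel₀ hv, one_pow]
        have eA : v⁻¹ ^ p * A.eval v = v⁻¹ ^ p - v⁻¹ := by
          simp only [hA, eval_sub, eval_one, eval_pow, eval_X]; rw [mul_sub, e3, mul_one]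
        have eB : v⁻¹ ^ p * B.eval v = t + (t + (v⁻¹ ^ p - v⁻¹)) := by
          simp only [hB, eval_sub, eval_add, eval_mul, eval_C, eval_one, eval_pow, eval_X]
          linear_combination -e3 + 2 * t * e4
        rw [eval_mul, eval_pow, ← eB]
        linear_combination (-(v⁻¹ ^ p * B.eval v) ^ 2) * (-eA)
      rw [e2, map_mul, map_pow, h3 _ (neg_ne_zero.mpr (pow_ne_zero _ (inv_ne_zero hv))), one_mul]
  have hs : ∑ y : E, η ((t - (y ^ p - y)) * (t + (y ^ p - y)) ^ 2) = (∑ v : E, η ((A * B ^ 2).eval v)) - 1 := by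
    rw [← Equiv.sum_comp (Equiv.addLeft y0), ← Equiv.sum_comp (inv_involutive (G := E)).toPerm]
    simp only [Equiv.coe_addLeft, Function.Involutive.coe_toPerm]
    simp_rw [key]
    rw [Finset.sum_sub_distrib]
    simp
  rw [hs]
  refine (norm_sub_le _ _).trans ?_
  rw [norm_one, add_comm]
  gcongr


noncomputable def lamf {p : ℕ} [Fact p.Prime] {F : Type*} [Field F] [Algebra (ZMod p) F]
    (χ : F →* ℂ) (ψ : AddChar (ZMod p) ℂ) (θ : F) (c : ZMod p) (f : (ZMod p)[X]) : ℂ :=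
  χ (aeval θ f) * ψ (c * f.nextCoeff)

lemma eta_sum_zero {F : Type*} [Field F] [Fintype F] (χ : F →* ℂ) (hne : ∃ x, x ≠ 0 ∧ χ x ≠ 1) :
    ∑ z, χ z = 0 := by
  obtain ⟨g, hg, hg1⟩ := hne
  have : χ g * ∑ z, χ z = 1 * ∑ z, χ z := by
    rw [Finset.mul_sum, one_mul, ← Equiv.sum_comp (Equiv.mulLeft₀ g hg) (fun z => χ z)]
    exact Finset.sum_congr rfl fun z _ => by simp
  by_contra h
  exact hg1 (mul_right_cancel₀ h this)

lemma exists_lin (p : ℕ) [Fact p.Prime] {F : Type*} [Field F] [Fintype F]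
    [Algebra (ZMod p) F] (hodd : Odd p) (hF : Module.finrank (ZMod p) F = 2) (θ : F) (hθ0 : θ ≠ 0)
    (hθ : θ ^ p = -θ) (z : F) : ∃ g : (ZMod p)[X], g.natDegree ≤ 1 ∧ aeval θ g = z := by
  have hpp := (Fact.out : p.Prime)
  have : CharP F p := charP_of_injective_algebraMap (algebraMap (ZMod p) F).injective p
  have h2 : (2 : F) ≠ 0 := by
    have := (CharP.cast_eq_zero_iff F p 2).not.mpr (by
      intro h; have := (Nat.prime_dvd_prime_iff_eq hpp Nat.prime_two).mp h; subst this
      exact absurd hodd (by decide))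
    exact_mod_cast this
  have hcF : Fintype.card F = p ^ 2 := by
    rw [← hF, Module.card_eq_pow_finrank (K := ZMod p), ZMod.card]
  let φ : ZMod p × ZMod p → F := fun x => algebraMap (ZMod p) F x.1 + algebraMap (ZMod p) F x.2 * θ
  have hnot : ∀ a : ZMod p, algebraMap (ZMod p) F a ≠ θ := by
    intro a ha
    have h1 : θ ^ p = θ := by rw [← ha, ← map_pow, ZMod.pow_card]
    rw [hθ] at h1
    have : 2 * θ = 0 := by linear_combination -h1
    exact (mul_ne_zero h2 hθ0) this
  have hinj : Function.Injective φ := by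
    rintro ⟨x, y⟩ ⟨x', y'⟩ h
    simp only [φ] at h
    have hy : y = y' := by
      by_contra hy
      have hd : algebraMap (ZMod p) F (y - y') ≠ 0 := by
        rw [Ne, map_eq_zero]; exact sub_ne_zero.mpr hy
      apply hnot ((x' - x) / (y - y'))
      rw [map_div₀, div_eq_iff hd, map_sub, map_sub]
      linear_combination -h
    subst hy
    have := (algebraMap (ZMod p) F).injective (add_right_cancel h)
    rw [this]
  have hbij : Function.Bijective φ := by
    rw [Fintype.bijective_iff_injective_and_card]
    exact ⟨hinj, by rw [Fintype.card_prod, ZMod.card, hcF, sq]⟩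
  obtain ⟨⟨x, y⟩, hxy⟩ := hbij.2 z
  refine ⟨C y * X + C x, natDegree_linear_le, ?_⟩
  rw [← hxy]; simp [φ, add_comm]

lemma lam_vanish (p : ℕ) [Fact p.Prime] {F : Type*} [Field F] [Fintype F]
    [Algebra (ZMod p) F] (hodd : Odd p) (hF : Module.finrank (ZMod p) F = 2) (θ : F) (hθ0 : θ ≠ 0)
    (hθ : θ ^ p = -θ) (χ : F →* ℂ) (hne : ∃ x, x ≠ 0 ∧ χ x ≠ 1) (ψ : AddChar (ZMod p) ℂ) (c : ZMod p)
    (n : ℕ) (hn : 3 ≤ n) : ∑ f ∈ mon (ZMod p) n, lamf χ ψ θ c f = 0 := by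
  choose g hg1 hg2 using exists_lin p hodd hF θ hθ0 hθ
  have hstep : ∀ z : F, ∑ f ∈ mon (ZMod p) n, lamf χ ψ θ c f =
      ∑ f ∈ mon (ZMod p) n, χ (aeval θ f + z) * ψ (c * f.nextCoeff) := by
    intro z
    have hmem : ∀ f ∈ mon (ZMod p) n, ∀ u : (ZMod p)[X], u.natDegree ≤ 1 →
        f + u ∈ mon (ZMod p) n ∧ (f + u).nextCoeff = f.nextCoeff := by
      intro f hf u hu
      rw [mem_mon] at hf
      have hlt : u.natDegree < f.natDegree := by omega
      have hd : (f + u).natDegree = n := by rw [natDegree_add_eq_left_of_natDegree_lt hlt, hf.2]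
      refine ⟨mem_mon.mpr ⟨hf.1.add_of_left (degree_lt_degree hlt), hd⟩, ?_⟩
      rw [nextCoeff_of_natDegree_pos (by omega), nextCoeff_of_natDegree_pos (by omega), hd, hf.2, coeff_add,
        coeff_eq_zero_of_natDegree_lt (show u.natDegree < n - 1 by omega), add_zero]
    symm
    refine Finset.sum_nbij' (fun f => f + g z) (fun f => f + -g z) ?_ ?_ ?_ ?_ ?_
    · intro f hf; exact (hmem f hf _ (hg1 z)).1
    · intro f hf; exact (hmem f hf _ (by rw [natDegree_neg]; exact hg1 z)).1
    · intro f _; simp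
    · intro f _; simp
    · intro f hf
      simp only [lamf]
      rw [(hmem f hf _ (hg1 z)).2, map_add (aeval θ), hg2]
  have : (Fintype.card F : ℂ) * ∑ f ∈ mon (ZMod p) n, lamf χ ψ θ c f = 0 := by
    rw [← nsmul_eq_mul, ← Finset.card_univ, ← Finset.sum_const, Finset.sum_congr rfl (fun z _ => hstep z), Finset.sum_comm]
    refine Finset.sum_eq_zero fun f _ => ?_
    have e := Equiv.sum_comp (Equiv.addLeft (aeval θ f)) (fun z => χ z)
    simp only [Equiv.coe_addLeft] at e
    rw [← Finset.sum_mul, e, eta_sum_zero χ hne, zero_mul]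
  exact (mul_eq_zero.mp this).resolve_left (by exact_mod_cast Fintype.card_ne_zero)

lemma lam_roots (p : ℕ) [Fact p.Prime] {F : Type*} [Field F] [Fintype F]
    [Algebra (ZMod p) F] (hodd : Odd p) (hF : Module.finrank (ZMod p) F = 2) (θ : F) (hθ0 : θ ≠ 0)
    (hθ : θ ^ p = -θ) (χ : F →* ℂ) (hne : ∃ x, x ≠ 0 ∧ χ x ≠ 1) (ψ : AddChar (ZMod p) ℂ) (c : ZMod p) :
    ∃ a b : ℂ, ∀ n ≥ 1, psum (lamf χ ψ θ c) n = -(a ^ n + b ^ n) := by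
  refine exists_roots _ ?_ ?_ ?_
  · simp [lamf, nextCoeff]
  · intro f g hf hg
    simp only [lamf]
    rw [hf.nextCoeff_mul hg, map_mul, map_mul, mul_add, AddChar.map_add_eq_mul]
    ring
  · intro n hn
    exact lam_vanish p hodd hF θ hθ0 hθ χ hne ψ c n hn

lemma psum_sum_bound (p : ℕ) [Fact p.Prime] {F E : Type*} [Field F] [Fintype F] [Field E] [Fintype E]
    [Algebra (ZMod p) F] [Algebra (ZMod p) E] [Algebra F E] [IsScalarTower (ZMod p) F E]
    (hodd : Odd p) (hp3 : p % 3 = 2)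
    (hF : Module.finrank (ZMod p) F = 2) (θ : F) (hθ0 : θ ≠ 0) (hθ : θ ^ p = -θ)
    (χ : F →* ℂ) (h0 : χ 0 = 0) (h3 : ∀ x, x ≠ 0 → χ x ^ 3 = 1) (hne : ∃ x, x ≠ 0 ∧ χ x ≠ 1)
    (ψ : AddChar (ZMod p) ℂ) (hψ : ψ.IsPrimitive) (m : ℕ) (hm : 27 * p ≤ m)
    (hE : Module.finrank F E = 2 * m) :
    ‖∑ c : ZMod p, psum (lamf χ ψ θ c) (4 * m)‖ ≤
      1 + (3 * (3 * p - 1 : ℕ) + 2 * (5 * (3 * p - 1 : ℕ) + 1) * (p : ℝ) ^ (2 * m)) := by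
  classical
  have hpp := (Fact.out : p.Prime)
  have : CharP E p := charP_of_injective_algebraMap (algebraMap (ZMod p) E).injective p
  have hn : Module.finrank (ZMod p) E = 4 * m := by
    rw [← Module.finrank_mul_finrank (ZMod p) F E, hF, hE]; ring
  let η : E →* ℂ := χ.comp (Algebra.norm F)
  have hη : ∀ x, η x = χ (Algebra.norm F x) := fun x => rfl
  have η0 : η 0 = 0 := by rw [hη, Algebra.norm_zero, h0]
  have η3 : ∀ x, x ≠ 0 → η x ^ 3 = 1 := fun x hx => by
    rw [hη]; exact h3 _ (Algebra.norm_ne_zero_iff.mpr hx)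
  have ηne : ∃ x, x ≠ 0 ∧ η x ≠ 1 := by
    obtain ⟨x, hx, hx1⟩ := hne
    obtain ⟨y, rfl⟩ := FiniteField.norm_surjective F E x
    exact ⟨y, by rintro rfl; simp at hx, hx1⟩
  set t := algebraMap F E θ with ht
  have e1 : ∑ c : ZMod p, psum (lamf χ ψ θ c) (4 * m) =
      ∑ y : E, η ((t - (y ^ p - y)) * (t + (y ^ p - y)) ^ 2) := by
    rw [trace_zero_sum p (fun b : E => η ((t - b) * (t + b) ^ 2)), Finset.mul_sum, Finset.sum_filter]
    have : ∀ c : ZMod p, psum (lamf χ ψ θ c) (4 * m) =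
        ∑ b : E, η ((t - b) * (t + b) ^ 2) * ψ (c * (- Algebra.trace (ZMod p) E b)) := by
      intro c
      rw [psum_eq _ E _ hn]
      refine Finset.sum_congr rfl fun b _ => ?_
      rw [lamf, mul_pow, ← hn, eta_minpoly p hodd hp3 hF θ hθ χ η hη η0 η3, psi_minpoly, mul_neg]
    simp_rw [this]
    rw [Finset.sum_comm]
    refine Finset.sum_congr rfl fun b _ => ?_
    rw [← Finset.mul_sum, AddChar.sum_mulShift _ hψ]
    simp only [neg_eq_zero, ZMod.card]
    split_ifs <;> simp [mul_comm]
  have hp2 : p ^ (2 * m) % 3 = 1 := by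
    rw [pow_mul, Nat.pow_mod, Nat.pow_mod p, hp3]; simp
  have hlt : 2 * m < p ^ (2 * m) := Nat.lt_pow_self hpp.one_lt
  obtain ⟨e, he⟩ : ∃ e, p ^ (2 * m) = 3 * e + 1 := ⟨p ^ (2 * m) / 3, by omega⟩
  rw [e1]
  refine as_sum_bound p hodd hp3 t ?_ ?_ (2 * m) e he ?_ (by omega) η η0 η3 ηne
  · rw [ht, Ne, map_eq_zero]; exact hθ0
  · rw [ht, ← map_pow, hθ, map_neg]
  · rw [Module.card_eq_pow_finrank (K := ZMod p), ZMod.card, hn, ← pow_mul]; congr 1; ring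

lemma psum_one (p : ℕ) [Fact p.Prime] {F : Type*} [Field F] [Fintype F]
    [Algebra (ZMod p) F] (θ : F) (χ : F →* ℂ) (ψ : AddChar (ZMod p) ℂ) (c : ZMod p) :
    psum (lamf χ ψ θ c) 1 = ∑ b : ZMod p, χ (θ - algebraMap (ZMod p) F b) * ψ (-(c * b)) := by
  rw [psum_eq _ (ZMod p) 1 (Module.finrank_self _)]
  refine Finset.sum_congr rfl fun b _ => ?_
  rw [minpoly.eq_X_sub_C', natDegree_X_sub_C, Nat.div_one, pow_one, lamf, nextCoeff_X_sub_C]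
  simp

theorem mixed_bound (p : ℕ) [Fact p.Prime] {F : Type} [Field F] [Fintype F]
    [Algebra (ZMod p) F]
    (hodd : Odd p) (hp3 : p % 3 = 2)
    (hF : Module.finrank (ZMod p) F = 2) (θ : F) (hθ0 : θ ≠ 0) (hθ : θ ^ p = -θ)
    (χ : F →* ℂ) (h0 : χ 0 = 0) (h3 : ∀ x, x ≠ 0 → χ x ^ 3 = 1) (hne : ∃ x, x ≠ 0 ∧ χ x ≠ 1)
    (ψ : AddChar (ZMod p) ℂ) (hψ : ψ.IsPrimitive) (c : ZMod p) :
    ‖∑ b : ZMod p, χ (θ - algebraMap (ZMod p) F b) * ψ (-(c * b))‖ ≤ 2 * Real.sqrt p := by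
  have hpp := (Fact.out : p.Prime)
  have : CharP F p := charP_of_injective_algebraMap (algebraMap (ZMod p) F).injective p
  choose a b hab using lam_roots p hodd hF θ hθ0 hθ χ hne ψ
  rw [← psum_one, hab c 1 le_rfl, norm_neg, pow_one, pow_one]
  have hp0 : (0 : ℝ) < p := by exact_mod_cast hpp.pos
  have hp1 : (1 : ℝ) ≤ p := by exact_mod_cast hpp.one_lt.le
  let w : ZMod p × Bool → ℂ := fun x => if x.2 then a x.1 else b x.1
  let z : ZMod p × Bool → ℂ := fun x => w x ^ 4 / (p : ℂ) ^ 2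
  have hz : ∀ i, ‖z i‖ ≤ 1 := by
    refine power_sum_bound z (1 + (3 * (3 * p - 1 : ℕ) + 2 * (5 * (3 * p - 1 : ℕ) + 1))) (27 * p) ?_
    intro m hm
    have hm0 : 2 * m ≠ 0 := by have := hpp.pos; omega
    have : NeZero (2 * m) := ⟨hm0⟩
    let _ : Fintype (FiniteField.Extension F p (2 * m)) := Fintype.ofFinite _
    have hb := psum_sum_bound p (E := FiniteField.Extension F p (2 * m)) hodd hp3 hF θ hθ0 hθ χ h0 h3 hne ψ hψ m hm
      (FiniteField.finrank_extension F p (2 * m))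
    have e1 : ∑ i, z i ^ m = -(∑ c : ZMod p, psum (lamf χ ψ θ c) (4 * m)) / (p : ℂ) ^ (2 * m) := by
      rw [Fintype.sum_prod_type, ← Finset.sum_neg_distrib, Finset.sum_div]
      refine Finset.sum_congr rfl fun c _ => ?_
      rw [hab c (4 * m) (by omega)]
      simp only [Fintype.sum_bool, z, w, if_true, div_pow, ← pow_mul]
      simp
      ring
    rw [e1, norm_div, norm_neg, norm_pow, Complex.norm_natCast, div_le_iff₀ (by positivity)]
    refine hb.trans ?_
    have hP : (1 : ℝ) ≤ (p : ℝ) ^ (2 * m) := one_le_pow₀ hp1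
    generalize ((p : ℝ) ^ (2 * m)) = P at *
    have hD : (0 : ℝ) ≤ ((3 * p - 1 : ℕ) : ℝ) := Nat.cast_nonneg _
    generalize ((3 * p - 1 : ℕ) : ℝ) = D at *
    nlinarith
  have hw : ∀ i, ‖w i‖ ≤ Real.sqrt p := by
    intro i
    have := hz i
    simp only [z] at this
    rw [norm_div, norm_pow, norm_pow, Complex.norm_natCast, div_le_one (by positivity)] at this
    refine le_of_pow_le_pow_left₀ (n := 4) (by norm_num) (Real.sqrt_nonneg _) (this.trans_eq ?_)
    rw [show 4 = 2 * 2 from rfl, pow_mul, Real.sq_sqrt hp0.le]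
  refine (norm_add_le _ _).trans ?_
  have h1 := hw (c, true)
  have h2 := hw (c, false)
  simp only [w, if_true] at h1
  simp [w] at h2
  linarith


lemma mulChar_props {F : Type*} [Field F] [Fintype F] (χ : MulChar F ℂ) (h : χ ^ 3 = 1) (h1 : χ ≠ 1) :
    χ.toMonoidHom 0 = 0 ∧ (∀ x, x ≠ 0 → χ.toMonoidHom x ^ 3 = 1) ∧ (∃ x, x ≠ 0 ∧ χ.toMonoidHom x ≠ 1) := by
  refine ⟨χ.map_nonunit (by simp), ?_, ?_⟩
  · intro x hx
    have : (χ ^ 3) x = (1 : MulChar F ℂ) x := by rw [h]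
    rw [MulChar.pow_apply' _ (by norm_num), MulChar.one_apply (IsUnit.mk0 x hx)] at this
    exact this
  · obtain ⟨a, ha⟩ := MulChar.ne_one_iff.mp h1
    exact ⟨a, a.ne_zero, ha⟩

lemma nsEps_spec (p : ℕ) [Fact p.Prime] (hodd : Odd p) :
    ¬ ∃ x : ZMod p, x ^ 2 = nsEps p := by
  have hpp := (Fact.out : p.Prime)
  have hne : {n : ℕ | 0 < n ∧ ¬∃ x : ZMod p, x ^ 2 = (n : ZMod p)}.Nonempty := by
    obtain ⟨a, ha⟩ := FiniteField.exists_nonsquare (F := ZMod p) (by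
      rw [ZMod.ringChar_zmod_n]; rintro rfl; exact absurd hodd (by decide))
    refine ⟨a.val, ?_, ?_⟩
    · rw [Nat.pos_iff_ne_zero, Ne, ZMod.val_eq_zero]
      rintro rfl; exact ha (IsSquare.zero)
    · rintro ⟨x, hx⟩
      rw [ZMod.natCast_zmod_val] at hx
      exact ha ⟨x, by rw [← hx, sq]⟩
  exact (Nat.sInf_mem hne).2

lemma nsEps_two : nsEps 2 = 0 := by
  have : {n : ℕ | 0 < n ∧ ¬∃ x : ZMod 2, x ^ 2 = (n : ZMod 2)} = ∅ := by
    ext n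
    simp only [Set.mem_ofPred_eq, Set.mem_empty_iff_false, iff_false, not_and, not_not]
    intro _
    exact ⟨(n : ZMod 2), by generalize (n : ZMod 2) = a; revert a; decide⟩
  rw [nsEps, leastNonResidue, this]; simp

lemma cfun_eq (p : ℕ) [Fact p.Prime] (r : GaloisField p 2) (s : ZMod p) [DecidablePred fun b => (s, b) ∈ Ocubes p r] :
    cfun p r s = ∑ b : ZMod p, if (s, b) ∈ Ocubes p r then ZMod.stdAddChar b else 0 := by
  rw [cfun, ← Finset.sum_filter]
  rw [finsum_mem_eq_sum_of_inter_support_eq (t := Finset.univ.filter fun b => (s, b) ∈ Ocubes p r)]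
  · refine Finset.sum_congr rfl fun b _ => ?_
    rw [ZMod.stdAddChar_apply, ZMod.toCircle_apply]
  · simp

lemma cfun_two (r : GaloisField 2 2) (hr : r ^ 2 = algebraMap (ZMod 2) (GaloisField 2 2) (nsEps 2))
    (s : ZMod 2) (hs : s ≠ 0) : cfun 2 r s = 0 := by
  classical
  rw [nsEps_two, map_zero, sq_eq_zero_iff] at hr
  have hs1 : s = 1 := by revert s; decide
  subst hs1 hr
  rw [cfun_eq]
  have : ∀ b : ZMod 2, ((1 : ZMod 2), b) ∈ Ocubes 2 0 := by
    intro b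
    refine ⟨by simp, 1, one_ne_zero, by simp⟩
  simp only [this, if_true]
  exact AddChar.sum_eq_zero_of_ne_one (by
    have := ZMod.isPrimitive_stdAddChar 2
    have := this (a := 1) one_ne_zero
    rwa [AddChar.mulShift_one] at this)

lemma abs_cfun_le_odd (p : ℕ) [Fact p.Prime] (hodd : Odd p) (hp3 : p % 3 = 2)
    (r : GaloisField p 2)
    (hr : r ^ 2 = algebraMap (ZMod p) (GaloisField p 2) (nsEps p))
    (s : ZMod p) (hs : s ≠ 0) :
    ‖cfun p r s‖ ≤ 4 / 3 * Real.sqrt p := by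
  classical
  have hpp := (Fact.out : p.Prime)
  let _ : Fintype (GaloisField p 2) := Fintype.ofFinite _
  have hF : Module.finrank (ZMod p) (GaloisField p 2) = 2 := GaloisField.finrank p (by norm_num)
  have hcF : Fintype.card (GaloisField p 2) = p ^ 2 := by
    rw [← Nat.card_eq_fintype_card, GaloisField.card p 2 (by norm_num)]
  have hns := nsEps_spec p hodd
  have hε0 : nsEps p ≠ 0 := fun h => hns ⟨0, by rw [h]; simp⟩
  have hr0 : r ≠ 0 := by
    rintro rfl
    apply hε0
    have h := hr.symm
    rw [zero_pow (by norm_num), map_eq_zero] at h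
    exact h
  have hrp : r ^ p = -r := by
    have h1 : nsEps p ^ (p / 2) = -1 := by
      rcases ZMod.pow_div_two_eq_neg_one_or_one p hε0 with h | h
      · exact absurd ((ZMod.euler_criterion p hε0).mpr h) (fun ⟨x, hx⟩ => hns ⟨x, by rw [hx, sq]⟩)
      · exact h
    have h2 : p = 2 * (p / 2) + 1 := by obtain ⟨k, hk⟩ := hodd; omega
    rw [show r ^ p = r ^ (2 * (p / 2) + 1) from congrArg (fun n : ℕ => r ^ n) h2, pow_succ, pow_mul, hr, ← map_pow, h1, map_neg, map_one, neg_one_mul]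
  set A := algebraMap (ZMod p) (GaloisField p 2) with hA
  have hAp : ∀ a, A a ^ p = A a := fun a => by rw [← map_pow, ZMod.pow_card]
  set θ : GaloisField p 2 := -(A s / r) with hθ
  have hAs : A s ≠ 0 := by rw [Ne, map_eq_zero]; exact hs
  have hθ0 : θ ≠ 0 := neg_ne_zero.mpr (div_ne_zero hAs hr0)
  have hθp : θ ^ p = -θ := by
    rw [hθ, hodd.neg_pow, div_pow, hAp, hrp, div_neg]
  have h2 : (2 : GaloisField p 2) ≠ 0 := by
    have := (CharP.cast_eq_zero_iff (GaloisField p 2) p 2).not.mpr (by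
      intro h; have := (Nat.prime_dvd_prime_iff_eq hpp Nat.prime_two).mp h; subst this
      exact absurd hodd (by decide))
    exact_mod_cast this
  have hx0 : ∀ b, A s + A b * r ≠ 0 := by
    intro b h
    have h' : (A s + A b * r) ^ p = 0 := by rw [h, zero_pow hpp.ne_zero]
    rw [add_pow_char, mul_pow, hAp, hAp, hrp] at h'
    exact (mul_ne_zero h2 hAs) (by linear_combination h + h')
  have hfac : ∀ b, A s + A b * r = -r * (θ - A b) := by
    intro b
    rw [hθ]; field_simp; ring
  obtain ⟨χ, hχ⟩ : ∃ χ : MulChar (GaloisField p 2) ℂ, orderOf χ = 3 := by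
    refine MulChar.exists_mulChar_orderOf (GaloisField p 2) ?_ (Complex.isPrimitiveRoot_exp 3 (by norm_num))
    rw [hcF]
    have : p ^ 2 % 3 = 1 := by rw [Nat.pow_mod, hp3]
    omega
  have hχ3 : χ ^ 3 = 1 := by rw [← hχ]; exact pow_orderOf_eq_one χ
  have hχ1 : χ ≠ 1 := by rintro rfl; simp at hχ
  have hχ2 : χ ^ 2 ≠ 1 := by
    intro h; have := orderOf_dvd_of_pow_eq_one h; rw [hχ] at this; omega
  obtain ⟨a0, a3, an⟩ := mulChar_props χ hχ3 hχ1
  obtain ⟨b0, b3, bn⟩ := mulChar_props (χ ^ 2) (by rw [← pow_mul, mul_comm, pow_mul, hχ3, one_pow]) hχ2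
  have hψ := ZMod.isPrimitive_stdAddChar p
  have B1 := mixed_bound p hodd hp3 hF θ hθ0 hθp χ.toMonoidHom a0 a3 an ZMod.stdAddChar hψ (-1)
  have B2 := mixed_bound p hodd hp3 hF θ hθ0 hθp (χ ^ 2).toMonoidHom b0 b3 bn ZMod.stdAddChar hψ (-1)
  have hsq : ∀ x, (χ ^ 2).toMonoidHom x = χ.toMonoidHom x ^ 2 := fun x => MulChar.pow_apply' _ (by norm_num) x
  set X1 := χ.toMonoidHom with hX1
  set X2 := (χ ^ 2).toMonoidHom with hX2
  simp only [neg_one_mul, neg_neg] at B1 B2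
  have hind : ∀ b, 3 * (if (s, b) ∈ Ocubes p r then (ZMod.stdAddChar b : ℂ) else 0) =
      ZMod.stdAddChar b + X1 (-r) * (X1 (θ - A b) * ZMod.stdAddChar b)
        + X2 (-r) * (X2 (θ - A b) * ZMod.stdAddChar b) := by
    intro b
    rw [← mul_assoc, ← mul_assoc, ← map_mul, ← map_mul, ← hfac, hsq]
    by_cases h : (s, b) ∈ Ocubes p r
    · rw [if_pos h]
      obtain ⟨-, w, hw0, hw⟩ := h
      simp only [] at hw
      rw [← hw, map_pow, a3 w hw0]; ring
    · rw [if_neg h]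
      have hn1 : X1 (A s + A b * r) ≠ 1 := by
        intro h1
        obtain ⟨w, hw0, hw⟩ := eta_cube X1 a3 an _ (hx0 b) h1
        exact h ⟨by simp [Prod.ext_iff, hs], w, hw0, hw⟩
      have h31 := a3 _ (hx0 b)
      generalize X1 (A s + A b * r) = ω at *
      have : 1 + ω + ω ^ 2 = 0 := by
        have : (ω - 1) * (1 + ω + ω ^ 2) = 0 := by linear_combination h31
        exact (mul_eq_zero.mp this).resolve_left (sub_ne_zero.mpr hn1)
      linear_combination (-(ZMod.stdAddChar b : ℂ)) * this
  have hψ0 : ∑ b : ZMod p, (ZMod.stdAddChar b : ℂ) = 0 := AddChar.sum_eq_zero_of_ne_one (by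
    have := hψ (a := 1) one_ne_zero
    rwa [AddChar.mulShift_one] at this)
  have hsum : 3 * cfun p r s = X1 (-r) * ∑ b, X1 (θ - A b) * ZMod.stdAddChar b
      + X2 (-r) * ∑ b, X2 (θ - A b) * ZMod.stdAddChar b := by
    rw [cfun_eq, Finset.mul_sum, Finset.sum_congr rfl (fun b _ => hind b), Finset.sum_add_distrib,
      Finset.sum_add_distrib, hψ0, zero_add, Finset.mul_sum, Finset.mul_sum]
  have hnorm : ∀ z : ℂ, z ^ 3 = 1 → ‖z‖ = 1 := by
    intro z hz
    have : ‖z‖ ^ 3 = 1 := by rw [← norm_pow, hz, norm_one]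
    exact (pow_eq_one_iff_of_nonneg (norm_nonneg _) (by norm_num)).mp this
  have h3 : 3 * ‖cfun p r s‖ ≤ 2 * Real.sqrt p + 2 * Real.sqrt p := by
    have e : ‖(3 : ℂ) * cfun p r s‖ = 3 * ‖cfun p r s‖ := by rw [norm_mul]; norm_num
    rw [← e, hsum]
    refine (norm_add_le _ _).trans ?_
    rw [norm_mul, norm_mul, hnorm _ (a3 _ (neg_ne_zero.mpr hr0)), hnorm _ (b3 _ (neg_ne_zero.mpr hr0)), one_mul,
      one_mul]
    exact add_le_add B1 B2
  linarith


end helpers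

/-- **Lemma `kloosterman`**: for a prime `p ≡ 2 (mod 3)` and every `s ∈ 𝔽_p^×`,
`|c(s)| ≤ (4/3)·√p`. -/
theorem abs_cfun_le (p : ℕ) [Fact p.Prime] (hp3 : p % 3 = 2)
    (r : GaloisField p 2)
    (hr : r ^ 2 = algebraMap (ZMod p) (GaloisField p 2) (nsEps p))
    (s : ZMod p) (hs : s ≠ 0) :
    ‖cfun p r s‖ ≤ 4 / 3 * Real.sqrt p := by
  rcases (Fact.out : p.Prime).eq_two_or_odd' with h | h
  · subst h
    rw [cfun_two r hr s hs, norm_zero]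
    positivity
  · exact abs_cfun_le_odd p h hp3 r hr s hs
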